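/- arXiv:cs/0610151 — 2 statements merged into one kernel-verified Lean document; each statement's English description precedes it below -/
import Mathlib

section
/- (Theorem 1, discrete form.) Let β > ln 2. There exists a constant K' depending only on β such that for every i ≥ 1, every d ≥ 0, and every true bit string b ∈ {0,1}^{i+d}, in the discrete repeated-PPM Gaussian model with horizon n = i + d the probability that some candidate string c ∈ {0,1}^n with c_i ≠ b_i satisfies S(c) ≥ S(b) is at most K'·exp(−d·E(β)). In particular, the ML estimate of bit i formed with delay d slots has error probability at most K'·exp(−d·E(β)), uniformly over all bit positions i, so the repeated pulse-position-modulation code achieves the orthogonal-coding error exponent with respect to decoding delay for every bit. -/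
open MeasureTheory ProbabilityTheory

/-- The index set of the discrete repeated-PPM Gaussian model with horizon `n`:
pairs `(k, s)` with `1 ≤ k ≤ n` (represented by `k : Fin n`, standing for slot
`k+1`) and `s ∈ {0,1}^{k+1}` a candidate bit prefix for that slot. -/
abbrev PPMIdx (n : ℕ) : Type := Σ k : Fin n, (Fin (k.val + 1) → Bool)

/-- The length-`(k+1)` prefix of a bit string `c ∈ {0,1}^n`, for `k : Fin n`. -/
def prefixBits {n : ℕ} (c : Fin n → Bool) (k : Fin n) : Fin (k.val + 1) → Bool :=
  fun i => c (Fin.castLE k.isLt i)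

/-- The score of a candidate string `c` in the discrete repeated-PPM Gaussian
model with true string `b`, noise realization `z` and normalized per-bit energy
`β`: `S(c) = ∑_k Y_{k,(c_1,…,c_k)}` where
`Y_{k,s} = √(2β)·1{s = (b_1,…,b_k)} + N_{k,s}`. -/
noncomputable def ppmScore {n : ℕ} (β : ℝ) (b : Fin n → Bool)
    (z : PPMIdx n → ℝ) (c : Fin n → Bool) : ℝ :=
  ∑ k : Fin n,
    ((if prefixBits c k = prefixBits b k then Real.sqrt (2 * β) else 0) +
      z ⟨k, prefixBits c k⟩)

/-- The per-bit orthogonal-coding error exponent `E(β)`: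
`E(β) = (β/(2 ln 2) − 1)·ln 2` if `β > 4 ln 2`,
`E(β) = (√(β/ln 2) − 1)²·ln 2` if `ln 2 < β ≤ 4 ln 2`, and `E(β) = 0`
otherwise. -/
noncomputable def Eperbit (β : ℝ) : ℝ :=
  if 4 * Real.log 2 < β then (β / (2 * Real.log 2) - 1) * Real.log 2
  else if Real.log 2 < β then (Real.sqrt (β / Real.log 2) - 1) ^ 2 * Real.log 2
  else 0

/-- The noise exponent along two disjoint sets of coordinates, as a product over all coordinates. -/
lemma exp_add_sums_eq_prod {ι : Type*} [Fintype ι] [DecidableEq ι] (S T : Finset ι) (u v : ℝ)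
    (z : ι → ℝ) :
    Real.exp (u * ∑ x ∈ S, z x + v * ∑ x ∈ T, z x) =
      ∏ x, Real.exp (((if x ∈ S then u else 0) + (if x ∈ T then v else 0)) * z x) := by
  rw [← Real.exp_sum]
  simp [add_mul, Finset.sum_add_distrib, Finset.mul_sum, ite_mul, Finset.sum_ite_mem]

lemma integrable_exp_add_sums {ι : Type*} [Fintype ι] [DecidableEq ι] (S T : Finset ι)
    (u v : ℝ) :
    Integrable (fun z : ι → ℝ => Real.exp (u * ∑ x ∈ S, z x + v * ∑ x ∈ T, z x))
      (Measure.pi fun _ : ι => gaussianReal 0 1) := by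
  simp_rw [exp_add_sums_eq_prod]
  exact Integrable.fintype_prod
    (f := fun x y => Real.exp (((if x ∈ S then u else 0) + (if x ∈ T then v else 0)) * y))
    fun x => integrable_exp_mul_gaussianReal _

lemma integral_exp_add_sums {ι : Type*} [Fintype ι] [DecidableEq ι] {S T : Finset ι}
    (hST : Disjoint S T) (u v : ℝ) :
    ∫ z : ι → ℝ, Real.exp (u * ∑ x ∈ S, z x + v * ∑ x ∈ T, z x)
      ∂(Measure.pi fun _ : ι => gaussianReal 0 1) =
      Real.exp (S.card * u ^ 2 / 2 + T.card * v ^ 2 / 2) := by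
  have hmgf (s : ℝ) : ∫ y, Real.exp (s * y) ∂(gaussianReal 0 1) = Real.exp (s ^ 2 / 2) := by
    have h := congrFun (mgf_id_gaussianReal (μ := 0) (v := 1)) s
    simpa [mgf] using h
  have hsq (x : ι) : ((if x ∈ S then u else 0) + (if x ∈ T then v else 0)) ^ 2 / 2 =
      (if x ∈ S then u ^ 2 / 2 else 0) + (if x ∈ T then v ^ 2 / 2 else 0) := by
    by_cases hS : x ∈ S
    · simp [hS, Finset.disjoint_left.mp hST hS]
    · by_cases hT : x ∈ T <;> simp [hS, hT]
  simp_rw [exp_add_sums_eq_prod]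
  rw [integral_fintype_prod_eq_prod
    (f := fun x y => Real.exp (((if x ∈ S then u else 0) + (if x ∈ T then v else 0)) * y))]
  simp_rw [hmgf, hsq]
  rw [← Real.exp_sum]
  simp [Finset.sum_add_distrib, mul_div_assoc]

/-- Gallager's bound for the event that one of at most `2 ^ m` Gaussian path sums, each over `m`
coordinates disjoint from `S`, exceeds the sum over `S` shifted by `m * A`. -/
lemma gaussian_paths_gallager_bound {ι κ : Type*} [Fintype ι] [DecidableEq ι] (m : ℕ)
    (S : Finset ι) (D : Finset κ) (T : κ → Finset ι) (hS : S.card = m)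
    (hT : ∀ c ∈ D, (T c).card = m) (hdisj : ∀ c ∈ D, Disjoint S (T c))
    (hD : D.card ≤ 2 ^ m) (A ρ : ℝ) (hA : 0 ≤ A) (hρ0 : 0 ≤ ρ) (hρ1 : ρ ≤ 1) :
    (Measure.pi fun _ : ι => gaussianReal 0 1)
        {z | ∃ c ∈ D, ∑ x ∈ S, z x + m * A ≤ ∑ x ∈ T c, z x} ≤
      ENNReal.ofReal (Real.exp (m * (ρ * Real.log 2 - A ^ 2 / 2 * (ρ / (1 + ρ))))) := by
  have h1ρ : 0 < 1 + ρ := by linarith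
  obtain ⟨t, ht⟩ : ∃ t, t = A / (1 + ρ) := ⟨_, rfl⟩
  have ht0 : 0 ≤ t := ht ▸ div_nonneg hA h1ρ.le
  have hA' : A = t * (1 + ρ) := by rw [ht]; field_simp
  obtain ⟨γ, hγ⟩ : ∃ γ, γ = m * (Real.log 2 + t ^ 2 / 2) := ⟨_, rfl⟩
  let μ : Measure (ι → ℝ) := Measure.pi fun _ : ι => gaussianReal 0 1
  let P : (ι → ℝ) → Finset ι → ℝ := fun z U =>
    Real.exp (-(t * ρ) * ∑ x ∈ S, z x + t * ∑ x ∈ U, z x)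
  let H : (ι → ℝ) → ℝ := fun z => Real.exp (ρ * γ - t * ρ * (m * A)) *
    ((1 - ρ) * P z ∅ + ρ * Real.exp (-γ) * ∑ c ∈ D, P z (T c))
  have hPint (U : Finset ι) : Integrable (fun z => P z U) μ := integrable_exp_add_sums S U _ _
  have hHint : Integrable H μ :=
    (((hPint ∅).const_mul _).add
      ((integrable_finsetSum D fun c _ => hPint (T c)).const_mul _)).const_mul _
  have hH0 (z : ι → ℝ) : 0 ≤ H z := by
    have hP (U : Finset ι) : 0 ≤ P z U := (Real.exp_pos _).le
    exact mul_nonneg (Real.exp_pos _).le (add_nonneg (mul_nonneg (by linarith) (hP ∅))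
      (mul_nonneg (mul_nonneg hρ0 (Real.exp_pos _).le) (Finset.sum_nonneg fun c _ => hP (T c))))
  have hmean : ∫ z, H z ∂μ ≤
      Real.exp (m * (ρ * Real.log 2 - A ^ 2 / 2 * (ρ / (1 + ρ)))) := by
    have hempty : ∫ z, P z ∅ ∂μ = Real.exp (m * (t * ρ) ^ 2 / 2) := by
      simp only [P, μ]
      rw [integral_exp_add_sums (Finset.disjoint_empty_right S)]
      simp [hS]
    have hpath : ∀ c ∈ D, ∫ z, P z (T c) ∂μ =
        Real.exp (m * (t * ρ) ^ 2 / 2) * Real.exp (m * t ^ 2 / 2) := by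
      intro c hc
      simp only [P, μ]
      rw [integral_exp_add_sums (hdisj c hc), hS, hT c hc, ← Real.exp_add]
      simp
    have hcard : (D.card : ℝ) * Real.exp (m * t ^ 2 / 2) ≤ Real.exp γ := by
      have h2 : (D.card : ℝ) ≤ Real.exp (m * Real.log 2) := by
        rw [Real.exp_nat_mul, Real.exp_log two_pos]
        exact_mod_cast hD
      calc (D.card : ℝ) * Real.exp (m * t ^ 2 / 2)
          ≤ Real.exp (m * Real.log 2) * Real.exp (m * t ^ 2 / 2) := by gcongr
        _ = Real.exp γ := by rw [← Real.exp_add, hγ]; ring_nf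
    have hscaled : Real.exp (-γ) * (D.card * Real.exp (m * t ^ 2 / 2)) ≤ 1 := by
      calc _ ≤ Real.exp (-γ) * Real.exp γ := by gcongr
        _ = 1 := by rw [← Real.exp_add]; simp
    have heq : ∫ z, H z ∂μ = Real.exp (ρ * γ - t * ρ * (m * A)) *
        ((1 - ρ) * Real.exp (m * (t * ρ) ^ 2 / 2) + ρ * Real.exp (-γ) *
          (D.card * (Real.exp (m * (t * ρ) ^ 2 / 2) * Real.exp (m * t ^ 2 / 2)))) := by
      simp only [H]
      rw [integral_const_mul, integral_add ((hPint ∅).const_mul _)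
        ((integrable_finsetSum D fun c _ => hPint (T c)).const_mul _), integral_const_mul,
        integral_const_mul, integral_finsetSum D fun c _ => hPint (T c), hempty,
        Finset.sum_congr rfl hpath, Finset.sum_const, nsmul_eq_mul]
    have hexp : m * (ρ * Real.log 2 - A ^ 2 / 2 * (ρ / (1 + ρ))) =
        ρ * γ - t * ρ * (m * A) + m * (t * ρ) ^ 2 / 2 := by
      rw [hγ, hA']
      field_simp
      ring
    rw [heq, hexp, Real.exp_add]
    refine mul_le_mul_of_nonneg_left ?_ (Real.exp_pos _).le
    have := mul_le_mul_of_nonneg_left hscaled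
      (mul_nonneg hρ0 (Real.exp_pos (m * (t * ρ) ^ 2 / 2)).le)
    linarith
  have hsub : {z : ι → ℝ | ∃ c ∈ D, ∑ x ∈ S, z x + m * A ≤ ∑ x ∈ T c, z x} ⊆ {z | 1 ≤ H z} := by
    rintro z ⟨c, hc, hz⟩
    obtain ⟨V, hV⟩ : ∃ V, V = ∑ x ∈ S, z x + m * A := ⟨_, rfl⟩
    have hone : Real.exp (-(t * ρ) * ∑ x ∈ S, z x) * Real.exp (t * V) ≤ ∑ c ∈ D, P z (T c) := by
      refine le_trans ?_ (Finset.single_le_sum (f := fun c => P z (T c))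
        (fun _ _ => (Real.exp_pos _).le) hc)
      rw [← Real.exp_add]
      refine Real.exp_le_exp.mpr ?_
      rw [hV]
      gcongr
    have hconv : Real.exp (ρ * (t * V - γ)) ≤ (1 - ρ) + ρ * Real.exp (t * V - γ) := by
      have := convexOn_exp.2 (Set.mem_univ 0) (Set.mem_univ (t * V - γ))
        (by linarith : 0 ≤ 1 - ρ) hρ0 (by ring)
      simpa using this
    calc (1 : ℝ) = Real.exp (ρ * γ - t * ρ * (m * A)) *
          (Real.exp (-(t * ρ) * ∑ x ∈ S, z x) * Real.exp (ρ * (t * V - γ))) := by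
          rw [← Real.exp_add, ← Real.exp_add, eq_comm, Real.exp_eq_one_iff, hV]
          ring
      _ ≤ Real.exp (ρ * γ - t * ρ * (m * A)) *
          (Real.exp (-(t * ρ) * ∑ x ∈ S, z x) *
            ((1 - ρ) + ρ * Real.exp (t * V - γ))) := by gcongr
      _ = Real.exp (ρ * γ - t * ρ * (m * A)) *
          ((1 - ρ) * P z ∅ + ρ * Real.exp (-γ) *
            (Real.exp (-(t * ρ) * ∑ x ∈ S, z x) * Real.exp (t * V))) := by
          simp only [P, Finset.sum_empty, mul_zero, sub_eq_add_neg (t * V), Real.exp_add, Real.exp_zero]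
          ring
      _ ≤ H z := by
          simp only [H]
          gcongr
  have hmarkov := mul_meas_ge_le_integral_of_nonneg (Filter.Eventually.of_forall hH0) hHint 1
  rw [one_mul] at hmarkov
  calc μ {z | ∃ c ∈ D, ∑ x ∈ S, z x + m * A ≤ ∑ x ∈ T c, z x} ≤ μ {z | 1 ≤ H z} :=
        measure_mono hsub
    _ = ENNReal.ofReal (μ.real {z | 1 ≤ H z}) := (ofReal_measureReal).symm
    _ ≤ _ := ENNReal.ofReal_le_ofReal (hmarkov.trans hmean)

/-- The per-bit exponent is positive above the Shannon threshold and is attained by some Gallager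
parameter in `[0, 1]`. -/
lemma Eperbit_pos_and_attained (β : ℝ) (hβ : Real.log 2 < β) :
    0 < Eperbit β ∧ ∃ ρ : ℝ, 0 ≤ ρ ∧ ρ ≤ 1 ∧
      ρ * Real.log 2 - β * (ρ / (1 + ρ)) = -Eperbit β := by
  have hl : 0 < Real.log 2 := Real.log_pos one_lt_two
  unfold Eperbit
  by_cases h4 : 4 * Real.log 2 < β
  · rw [if_pos h4]
    refine ⟨mul_pos (sub_pos.mpr ?_) hl, 1, zero_le_one, le_rfl, ?_⟩
    · rw [lt_div_iff₀ (by positivity)]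
      linarith
    · field_simp
      ring
  · rw [if_neg h4, if_pos hβ]
    obtain ⟨s, hs⟩ : ∃ s, s = Real.sqrt (β / Real.log 2) := ⟨_, rfl⟩
    have hs2 : s ^ 2 = β / Real.log 2 := hs ▸ Real.sq_sqrt (div_nonneg (hl.trans hβ).le hl.le)
    have hβs : β = s ^ 2 * Real.log 2 := by rw [hs2]; field_simp
    have hs1 : 1 < s := by
      rw [hs, Real.lt_sqrt zero_le_one, one_pow, lt_div_iff₀ hl]
      linarith
    have hs2le : s ≤ 2 := by
      rw [hs, Real.sqrt_le_left two_pos.le, div_le_iff₀ hl]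
      linarith
    rw [← hs]
    refine ⟨by have := sub_pos.mpr hs1; positivity, s - 1, by linarith, by linarith, ?_⟩
    have hs0 : s ≠ 0 := by linarith
    rw [hβs, add_sub_cancel]
    field_simp
    ring

/-- At most `2 ^ (n - j)` strings agree with `b` before position `j`. -/
lemma card_agree_before_le {n : ℕ} (b : Fin n → Bool) (j : Fin n) :
    (Finset.univ.filter fun c : Fin n → Bool => (∀ k < j, c k = b k) ∧ c j ≠ b j).card ≤
      2 ^ (n - j.val) := by
  have hcard : (2 : ℕ) ^ (n - j.val) = (Finset.univ : Finset (Fin (n - j.val) → Bool)).card := by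
    simp
  rw [hcard]
  refine Finset.card_le_card_of_injOn (fun c k => c ⟨j.val + k.val, by omega⟩)
    (fun _ _ => Finset.mem_coe.mpr (Finset.mem_univ _)) ?_
  intro c hc c' hc' h
  simp only [Finset.coe_filter, Finset.mem_univ, true_and, Set.mem_ofPred_eq] at hc hc'
  funext k
  by_cases hk : k < j
  · rw [hc.1 k hk, hc'.1 k hk]
  · have hjk : j.val ≤ k.val := by simpa using hk
    have := congrFun h ⟨k.val - j.val, by omega⟩
    simpa [Nat.add_sub_cancel' hjk] using this

/-- The slots visited by the path of `c` from slot `j` on. -/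
def pathFrom {n : ℕ} (j : Fin n) (c : Fin n → Bool) : Finset (PPMIdx n) :=
  (Finset.Ici j).image fun k => ⟨k, prefixBits c k⟩

lemma pathFrom_injective {n : ℕ} (c : Fin n → Bool) :
    Function.Injective fun k : Fin n => (⟨k, prefixBits c k⟩ : PPMIdx n) :=
  fun _ _ h => congrArg Sigma.fst h

lemma card_pathFrom {n : ℕ} (j : Fin n) (c : Fin n → Bool) :
    (pathFrom j c).card = n - j.val := by
  rw [pathFrom, Finset.card_image_of_injective _ (pathFrom_injective c), Fin.card_Ici]

lemma sum_pathFrom {n : ℕ} (j : Fin n) (c : Fin n → Bool) (z : PPMIdx n → ℝ) :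
    ∑ x ∈ pathFrom j c, z x = ∑ k ∈ Finset.Ici j, z ⟨k, prefixBits c k⟩ := by
  rw [pathFrom, Finset.sum_image (pathFrom_injective c).injOn]

lemma prefixBits_eq_of_lt {n : ℕ} {b c : Fin n → Bool} {j k : Fin n}
    (h : ∀ l < j, c l = b l) (hk : k < j) : prefixBits c k = prefixBits b k := by
  funext l
  refine h _ (lt_of_le_of_lt ?_ hk)
  rw [Fin.le_def]
  simpa using Nat.lt_succ_iff.mp l.isLt

lemma prefixBits_ne_of_le {n : ℕ} {b c : Fin n → Bool} {j k : Fin n}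
    (h : c j ≠ b j) (hk : j ≤ k) : prefixBits c k ≠ prefixBits b k := fun heq =>
  h (congrFun heq ⟨j.val, Nat.lt_succ_iff.mpr hk⟩)

lemma disjoint_pathFrom {n : ℕ} {b c : Fin n → Bool} {j : Fin n} (h : c j ≠ b j) :
    Disjoint (pathFrom j b) (pathFrom j c) := by
  rw [Finset.disjoint_left]
  intro x hb hc
  simp only [pathFrom, Finset.mem_image, Finset.mem_Ici] at hb hc
  obtain ⟨k, hk, rfl⟩ := hb
  obtain ⟨l, hl, hlk⟩ := hc
  obtain rfl : l = k := congrArg Sigma.fst hlk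
  exact prefixBits_ne_of_le h hl (eq_of_heq (Sigma.mk.inj hlk).2)

/-- A wrong path that first leaves the true path at `j` and scores at least as high as the true
path must overcome the signal energy of the slots from `j` on. -/
lemma noise_of_ppmScore_ge {n : ℕ} (β : ℝ) {b c : Fin n → Bool} {j : Fin n}
    (hlt : ∀ k < j, c k = b k) (hne : c j ≠ b j) {z : PPMIdx n → ℝ}
    (h : ppmScore β b z c ≥ ppmScore β b z b) :
    ∑ x ∈ pathFrom j b, z x + (n - j.val : ℕ) * Real.sqrt (2 * β) ≤ ∑ x ∈ pathFrom j c, z x := by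
  rw [sum_pathFrom, sum_pathFrom]
  have hsplit (f : Fin n → ℝ) :
      ∑ k, f k = ∑ k ∈ Finset.Iio j, f k + ∑ k ∈ Finset.Ici j, f k := by
    rw [← Finset.sum_union]
    · congr 1
      ext k
      simp [lt_or_ge]
    · rw [Finset.disjoint_left]
      intro k hk hk'
      exact absurd (Finset.mem_Ici.mp hk') (not_le.mpr (Finset.mem_Iio.mp hk))
  unfold ppmScore at h
  rw [hsplit, hsplit] at h
  have hpre : ∑ k ∈ Finset.Iio j,
      ((if prefixBits c k = prefixBits b k then Real.sqrt (2 * β) else 0) +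
        z ⟨k, prefixBits c k⟩) =
      ∑ k ∈ Finset.Iio j,
      ((if prefixBits b k = prefixBits b k then Real.sqrt (2 * β) else 0) +
        z ⟨k, prefixBits b k⟩) :=
    Finset.sum_congr rfl fun k hk => by rw [prefixBits_eq_of_lt hlt (Finset.mem_Iio.mp hk)]
  have hsuf : ∑ k ∈ Finset.Ici j,
      ((if prefixBits c k = prefixBits b k then Real.sqrt (2 * β) else 0) +
        z ⟨k, prefixBits c k⟩) = ∑ k ∈ Finset.Ici j, z ⟨k, prefixBits c k⟩ :=
    Finset.sum_congr rfl fun k hk => by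
      rw [if_neg (prefixBits_ne_of_le hne (Finset.mem_Ici.mp hk)), zero_add]
  have htrue : ∑ k ∈ Finset.Ici j,
      ((if prefixBits b k = prefixBits b k then Real.sqrt (2 * β) else 0) +
        z ⟨k, prefixBits b k⟩) =
      (n - j.val : ℕ) * Real.sqrt (2 * β) + ∑ k ∈ Finset.Ici j, z ⟨k, prefixBits b k⟩ := by
    simp [Finset.sum_add_distrib]
  rw [hpre, hsuf, htrue] at h
  linarith

/-- The probability that some path first leaving the true path at `j` beats it decays with the
orthogonal-coding exponent in the number of remaining slots. -/
lemma measure_first_divergence_le (β : ℝ) (hβ : Real.log 2 < β) {n : ℕ} (b : Fin n → Bool)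
    (j : Fin n) :
    (Measure.pi fun _ : PPMIdx n => gaussianReal 0 1)
        {z | ∃ c : Fin n → Bool, ((∀ k < j, c k = b k) ∧ c j ≠ b j) ∧
          ppmScore β b z c ≥ ppmScore β b z b} ≤
      ENNReal.ofReal (Real.exp (-((n - j.val : ℕ) : ℝ) * Eperbit β)) := by
  have hβ0 : 0 < β := (Real.log_pos one_lt_two).trans hβ
  obtain ⟨-, ρ, hρ0, hρ1, hρ⟩ := Eperbit_pos_and_attained β hβ
  have hbound := gaussian_paths_gallager_bound (n - j.val) (pathFrom j b)
    (Finset.univ.filter fun c : Fin n → Bool => (∀ k < j, c k = b k) ∧ c j ≠ b j) (pathFrom j)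
    (card_pathFrom j b) (fun c _ => card_pathFrom j c)
    (fun c hc => disjoint_pathFrom (Finset.mem_filter.mp hc).2.2) (card_agree_before_le b j)
    (Real.sqrt (2 * β)) ρ (Real.sqrt_nonneg _) hρ0 hρ1
  rw [Real.sq_sqrt (by positivity), mul_div_cancel_left₀ β two_ne_zero, hρ, mul_neg,
    ← neg_mul] at hbound
  refine (measure_mono ?_).trans hbound
  rintro z ⟨c, hc, hz⟩
  exact ⟨c, by simpa using hc, noise_of_ppmScore_ge β hc.1 hc.2 hz⟩

/-- Theorem 1 (discrete form): repeated pulse-position modulation achieves the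
orthogonal-coding error exponent with respect to decoding delay for every bit.
For `β > ln 2` there is a constant `K'` (depending only on `β`) such that for
every bit position `i ≥ 1`, delay `d ≥ 0` and true string `b ∈ {0,1}^{i+d}`,
the probability that some candidate string `c` with `c_i ≠ b_i` scores at least
as high as `b` (hence the probability that the ML estimate of bit `i` formed
with delay `d` slots errs) is at most `K'·exp(−d·E(β))`, uniformly over bit
positions `i`. -/
theorem repeatedPPM_anytime_reliability (β : ℝ) (hβ : Real.log 2 < β) :
    ∃ K' : ℝ, 0 < K' ∧ ∀ (i d : ℕ) (hi : 1 ≤ i) (b : Fin (i + d) → Bool),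
      (Measure.pi fun _ : PPMIdx (i + d) => gaussianReal 0 1)
          {z | ∃ c : Fin (i + d) → Bool,
            c ⟨i - 1, by omega⟩ ≠ b ⟨i - 1, by omega⟩ ∧
            ppmScore β b z c ≥ ppmScore β b z b} ≤
        ENNReal.ofReal (K' * Real.exp (-(d : ℝ) * Eperbit β)) := by
  obtain ⟨hE, -⟩ := Eperbit_pos_and_attained β hβ
  obtain ⟨q, hq⟩ : ∃ q, q = Real.exp (-Eperbit β) := ⟨_, rfl⟩
  have hq0 : 0 < q := hq ▸ Real.exp_pos _
  have hq1 : q < 1 := by rw [hq, Real.exp_lt_one_iff]; linarith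
  have hqpow (m : ℕ) : Real.exp (-(m : ℝ) * Eperbit β) = q ^ m := by
    rw [hq, ← Real.exp_nat_mul]
    ring_nf
  refine ⟨(1 - q)⁻¹, inv_pos.mpr (sub_pos.mpr hq1), fun i d hi b => ?_⟩
  have hsub : {z : PPMIdx (i + d) → ℝ | ∃ c : Fin (i + d) → Bool,
        c ⟨i - 1, by omega⟩ ≠ b ⟨i - 1, by omega⟩ ∧ ppmScore β b z c ≥ ppmScore β b z b} ⊆
      ⋃ j : Fin i, {z | ∃ c : Fin (i + d) → Bool,
        ((∀ k < Fin.castAdd d j, c k = b k) ∧ c (Fin.castAdd d j) ≠ b (Fin.castAdd d j)) ∧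
          ppmScore β b z c ≥ ppmScore β b z b} := by
    rintro z ⟨c, hne, hz⟩
    have hex : ∃ k, ∃ hk : k < i, c ⟨k, by omega⟩ ≠ b ⟨k, by omega⟩ := ⟨i - 1, by omega, hne⟩
    classical
    obtain ⟨hlt, hfirst⟩ := Nat.find_spec hex
    refine Set.mem_iUnion.mpr ⟨⟨Nat.find hex, hlt⟩, c, ⟨fun k hk => ?_, hfirst⟩, hz⟩
    have hk' : k.val < Nat.find hex := hk
    have hmin := Nat.find_min hex hk'
    by_contra hck
    exact hmin ⟨hk'.trans hlt, hck⟩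
  refine (measure_mono hsub).trans ((measure_iUnion_fintype_le _ _).trans ?_)
  calc _ ≤ ∑ j : Fin i, ENNReal.ofReal (q ^ (i + d - j.val)) := by
        refine Finset.sum_le_sum fun j _ => ?_
        rw [← hqpow]
        exact measure_first_divergence_le β hβ b (Fin.castAdd d j)
    _ = ENNReal.ofReal (∑ j : Fin i, q ^ (i + d - j.val)) :=
        (ENNReal.ofReal_sum_of_nonneg fun j _ => by positivity).symm
    _ ≤ _ := by
        refine ENNReal.ofReal_le_ofReal ?_
        rw [hqpow, Fin.sum_univ_eq_sum_range (fun j => q ^ (i + d - j)),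
          ← Finset.sum_range_reflect]
        calc ∑ j ∈ Finset.range i, q ^ (i + d - (i - 1 - j))
            ≤ ∑ j ∈ Finset.range i, q ^ j * q ^ d := by
              refine Finset.sum_le_sum fun j hj => ?_
              have := Finset.mem_range.mp hj
              rw [← pow_add]
              exact pow_le_pow_of_le_one hq0.le hq1.le (by omega)
          _ = (∑ j ∈ Finset.range i, q ^ j) * q ^ d := (Finset.sum_mul _ _ _).symm
          _ ≤ (1 - q)⁻¹ * q ^ d := by
              gcongr
              rw [← tsum_geometric_of_lt_one hq0.le hq1]
              exact (summable_geometric_of_lt_one hq0.le hq1).sum_le_tsum _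
                fun _ _ => by positivity
end

section
/- (Upper bound on the delay error exponent.) Fix P > 0, N₀ > 0, a rate R with 0 < R < C∞ where C∞ = (P/N₀)·log₂ e, and set τ = 1/R. For every ε > 0 there exists d₀ such that for all delays d ≥ d₀, every dimension J ≥ 1, every causal encoder of dimension J satisfying the power constraint, and every delay-d decoder, there exists a bit index i ≥ 1 with P(B̂_i ≠ B_i) ≥ exp(−d·τ·(ln 2·(√C∞ − √R)² + ε)). Hence no fixed-delay code without feedback can achieve a delay error exponent exceeding ln 2·(√C∞ − √R)², which matches the high-rate branch of the orthogonal-coding exponent; the semi-orthogonal code is therefore asymptotically optimal at high rates. -/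
open MeasureTheory ProbabilityTheory

/-- The joint law of the message bits and channel noise in the slotted
fixed-delay AWGN coding model with horizon `n` slots and dimension `J`:
the `n` bits are i.i.d. uniform on `{0,1}` and the `n` noise vectors are
independent Gaussian vectors in `ℝ^J` with i.i.d. `N(0, N₀/2)` coordinates. -/
noncomputable def bitNoiseMeasure (n J : ℕ) (N0 : ℝ) :
    Measure ((Fin n → Bool) × (Fin n → Fin J → ℝ)) :=
  (Measure.pi fun _ : Fin n => (PMF.uniformOfFintype Bool).toMeasure).prod
    (Measure.pi fun _ : Fin n =>
      Measure.pi fun _ : Fin J => gaussianReal 0 (N0 / 2).toNNReal)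

open scoped ENNReal NNReal

section Domination

variable {M : Type*}

/-- Measurable, positively homogeneous functionals of message weights. -/
structure IsGauge (U : (M → ℝ) → ℝ≥0∞) : Prop where
  measurable : Measurable U
  homogeneous : ∀ r : ℝ, 0 < r → ∀ a, U (fun b => r * a b) = ENNReal.ofReal r * U a

/-- The value of `U` after observing a channel output whose law given `b` has density `k b`. -/
noncomputable def outputValue {Ω : Type*} [MeasureSpace Ω] (k : M → Ω → ℝ)
    (U : (M → ℝ) → ℝ≥0∞) : (M → ℝ) → ℝ≥0∞ :=
  fun a => ∫⁻ y, U (fun b => a b * k b y)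

lemma IsGauge.outputValue {Ω : Type*} [MeasureSpace Ω] [SFinite (volume : Measure Ω)]
    {k : M → Ω → ℝ} (hk : ∀ b, Measurable (k b)) {U : (M → ℝ) → ℝ≥0∞} (hU : IsGauge U) :
    IsGauge (outputValue k U) := by
  have hm : Measurable fun z : (M → ℝ) × Ω => U (fun b => z.1 b * k b z.2) :=
    hU.measurable.comp (measurable_pi_lambda _ fun b =>
      ((measurable_pi_apply b).comp measurable_fst).mul ((hk b).comp measurable_snd))
  refine ⟨hm.lintegral_prod_right', fun r hr a => ?_⟩
  unfold _root_.outputValue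
  refine Eq.trans (lintegral_congr fun y => ?_) (lintegral_const_mul (ENNReal.ofReal r)
    (hm.comp (measurable_prodMk_left (x := a))))
  simp only [mul_assoc, ← hU.homogeneous r hr]

variable [Fintype M]

/-- The order `1 + θ` likelihood-ratio moment of the weights `a` against `p`, relaxed by the
`μ`-th power of the total mass of `a`. -/
noncomputable def tiltedMoment (θ μ : ℝ) (a p : M → ℝ) : ℝ :=
  ∑ b, a b ^ (1 + θ - μ) * p b ^ (-θ) * (∑ b', a b') ^ μ

/-- A functional `U` of message weights is dominated by `V` up to the tilted moment. -/
def Dominated (θ μ : ℝ) (U V : (M → ℝ) → ℝ≥0∞) : Prop :=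
  ∀ a p : M → ℝ, (∀ b, 0 < a b) → (∀ b, 0 < p b) →
    U a ≤ V p + ENNReal.ofReal (tiltedMoment θ μ a p)

/-- Observing through `k` on the left and `l` on the right preserves domination. -/
def PreservesDomination (θ μ : ℝ) {Ω : Type*} [MeasureSpace Ω] (k l : M → Ω → ℝ) : Prop :=
  ∀ U V : (M → ℝ) → ℝ≥0∞, IsGauge U → IsGauge V → Dominated θ μ U V →
    Dominated θ μ (outputValue k U) (outputValue l V)

lemma PreservesDomination.prod {θ μ : ℝ} {Ω₁ Ω₂ : Type*} [MeasureSpace Ω₁] [MeasureSpace Ω₂]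
    [SFinite (volume : Measure Ω₁)] [SFinite (volume : Measure Ω₂)]
    {k₁ l₁ : M → Ω₁ → ℝ} {k₂ l₂ : M → Ω₂ → ℝ}
    (hk₁ : ∀ b, Measurable (k₁ b)) (hk₂ : ∀ b, Measurable (k₂ b))
    (hl₁ : ∀ b, Measurable (l₁ b)) (hl₂ : ∀ b, Measurable (l₂ b))
    (h₁ : PreservesDomination θ μ k₁ l₁) (h₂ : PreservesDomination θ μ k₂ l₂) :
    PreservesDomination θ μ (fun b (y : Ω₁ × Ω₂) => k₁ b y.1 * k₂ b y.2)
      (fun b (y : Ω₁ × Ω₂) => l₁ b y.1 * l₂ b y.2) := by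
  have key : ∀ {k₁ : M → Ω₁ → ℝ} {k₂ : M → Ω₂ → ℝ}, (∀ b, Measurable (k₁ b)) →
      (∀ b, Measurable (k₂ b)) → ∀ U : (M → ℝ) → ℝ≥0∞, IsGauge U →
      outputValue (fun b (y : Ω₁ × Ω₂) => k₁ b y.1 * k₂ b y.2) U =
        outputValue k₁ (outputValue k₂ U) := by
    intro k₁ k₂ h1 h2 U hU
    funext a
    unfold outputValue
    rw [Measure.volume_eq_prod, lintegral_prod]
    · simp only [mul_assoc]
    · exact (hU.measurable.comp (measurable_pi_lambda _ fun b => (((h1 b).comp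
        measurable_fst).mul ((h2 b).comp measurable_snd)).const_mul _)).aemeasurable
  intro U V hU hV hUV
  rw [key hk₁ hk₂ U hU, key hl₁ hl₂ V hV]
  exact h₁ _ _ (hU.outputValue hk₂) (hV.outputValue hl₂) (h₂ U V hU hV hUV)

lemma PreservesDomination.pi {θ μ : ℝ} {Ω : Type*} [MeasureSpace Ω]
    [SigmaFinite (volume : Measure Ω)] {n : ℕ} {k l : Fin n → M → Ω → ℝ}
    (hk : ∀ j b, Measurable (k j b)) (hl : ∀ j b, Measurable (l j b))
    (h : ∀ j, PreservesDomination θ μ (k j) (l j)) :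
    PreservesDomination θ μ (fun b (y : Fin n → Ω) => ∏ j, k j b (y j))
      (fun b (y : Fin n → Ω) => ∏ j, l j b (y j)) := by
  induction n with
  | zero =>
    intro U V _ _ hUV a p ha hp
    simpa [outputValue, volume_pi, Measure.pi_of_empty] using hUV a p ha hp
  | succ n ih =>
    have key : ∀ {k : Fin (n + 1) → M → Ω → ℝ}, ∀ U : (M → ℝ) → ℝ≥0∞,
        outputValue (fun b (y : Fin (n + 1) → Ω) => ∏ j, k j b (y j)) U =
        outputValue
          (fun b (y : Ω × (Fin n → Ω)) => k 0 b y.1 * ∏ j, k (Fin.succ j) b (y.2 j)) U := by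
      intro k U
      funext a
      unfold outputValue
      rw [← (volume_preserving_piFinSuccAbove (fun _ : Fin (n + 1) => Ω) 0).lintegral_comp_emb
        (MeasurableEquiv.measurableEmbedding _)]
      refine lintegral_congr fun y => ?_
      simp [Fin.prod_univ_succ, MeasurableEquiv.piFinSuccAbove, Fin.tail]
    intro U V hU hV hUV
    rw [key U, key V]
    refine PreservesDomination.prod (hk 0) (fun b => ?_) (hl 0) (fun b => ?_) (h 0)
      (ih (fun j => hk _) (fun j => hl _) (fun j => h _)) U V hU hV hUV
    · exact Finset.measurable_prod _ fun j _ => (hk _ b).comp (measurable_pi_apply j)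
    · exact Finset.measurable_prod _ fun j _ => (hl _ b).comp (measurable_pi_apply j)

end Domination

section GaussianStep

variable {M : Type*} [Fintype M]

lemma gaussianPDFReal_tilt {v : ℝ≥0} (hv : v ≠ 0) (α θ μ c c' m x x' y : ℝ)
    (hc : c = (1 + θ - μ) * α - θ) (hc' : c' = (1 + θ - μ) * α ^ 2 - θ) :
    gaussianPDFReal (m + α * x) v y ^ (1 + θ - μ) * gaussianPDFReal (m + x) v y ^ (-θ) *
        (gaussianPDFReal m v y ^ (μ - 1) * gaussianPDFReal (m + α * x') v y) =
      Real.exp ((c ^ 2 - c') / (2 * v) * x ^ 2 + α * c / v * (x * x')) *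
        gaussianPDFReal (m + c * x + α * x') v y := by
  have hv' : (v : ℝ) ≠ 0 := by exact_mod_cast hv
  have hpos : ∀ m : ℝ, 0 < gaussianPDFReal m v y := fun m => gaussianPDFReal_pos m v y hv
  have hlog : ∀ m : ℝ, Real.log (gaussianPDFReal m v y) =
      Real.log (√(2 * Real.pi * v))⁻¹ + -(y - m) ^ 2 / (2 * v) := by
    intro m
    have hZ : (√(2 * Real.pi * v))⁻¹ ≠ 0 := by
      have : (0 : ℝ) < v := lt_of_le_of_ne v.2 (Ne.symm hv')
      positivity
    rw [gaussianPDFReal, Real.log_mul hZ (Real.exp_pos _).ne', Real.log_exp]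
  apply Real.log_injOn_pos
  · have := hpos (m + α * x); have := hpos (m + x); have := hpos m; have := hpos (m + α * x')
    simp only [Set.mem_Ioi]; positivity
  · have := hpos (m + c * x + α * x')
    simp only [Set.mem_Ioi]; positivity
  rw [Real.log_mul, Real.log_mul, Real.log_mul, Real.log_mul, Real.log_exp, Real.log_rpow (hpos _),
    Real.log_rpow (hpos _), Real.log_rpow (hpos _), hlog, hlog, hlog, hlog, hlog, hc, hc']
  · field_simp
    ring
  all_goals
    have := hpos (m + α * x); have := hpos (m + x); have := hpos m; have := hpos (m + α * x')
    have := hpos (m + c * x + α * x')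
    positivity

lemma sum_mul_exp_le {π x : M → ℝ} {t r : ℝ} (hπ : ∀ b, 0 ≤ π b) (hπ1 : ∑ b, π b = 1)
    (hx0 : ∑ b, π b * x b = 0) (hx : ∀ b, |x b| ≤ r) (ht : |t| * r ≤ 1) :
    ∑ b, π b * Real.exp (t * x b) ≤ Real.exp (t ^ 2 * r ^ 2) := by
  have h1 : ∀ b, π b * Real.exp (t * x b) ≤ π b + t * (π b * x b) + π b * (t ^ 2 * r ^ 2) := by
    intro b
    have hb : |t * x b| ≤ 1 := by
      rw [abs_mul]; exact (mul_le_mul_of_nonneg_left (hx b) (abs_nonneg t)).trans ht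
    have h2 := (abs_le.1 (Real.abs_exp_sub_one_sub_id_le hb)).2
    have h3 : (x b) ^ 2 ≤ r ^ 2 := sq_le_sq' (by linarith [(abs_le.1 (hx b)).1]) (abs_le.1 (hx b)).2
    have h4 : (t * x b) ^ 2 ≤ t ^ 2 * r ^ 2 := by
      rw [mul_pow]; exact mul_le_mul_of_nonneg_left h3 (sq_nonneg t)
    have h5 : Real.exp (t * x b) ≤ 1 + t * x b + t ^ 2 * r ^ 2 := by linarith
    calc π b * Real.exp (t * x b) ≤ π b * (1 + t * x b + t ^ 2 * r ^ 2) :=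
          mul_le_mul_of_nonneg_left h5 (hπ b)
      _ = _ := by ring
  calc ∑ b, π b * Real.exp (t * x b)
      ≤ ∑ b, (π b + t * (π b * x b) + π b * (t ^ 2 * r ^ 2)) := Finset.sum_le_sum fun b _ => h1 b
    _ = 1 + t ^ 2 * r ^ 2 := by
        rw [Finset.sum_add_distrib, Finset.sum_add_distrib, ← Finset.mul_sum, ← Finset.sum_mul,
          hπ1, hx0]; ring
    _ ≤ _ := by linarith [Real.add_one_le_exp (t ^ 2 * r ^ 2)]

/-- The mixture factor of the tilted moment costs at most its linearization. -/
lemma rpow_le_one_sub_add_mul {h μ : ℝ} (hh : 0 ≤ h) (h0 : 0 ≤ μ) (h1 : μ ≤ 1) :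
    h ^ μ ≤ 1 - μ + μ * h := by
  have := Real.geom_mean_le_arith_mean2_weighted (sub_nonneg.2 h1) h0 zero_le_one hh (by ring)
  simpa using this

lemma lintegral_tilted_mixture_le {v : ℝ≥0} (hv : v ≠ 0) {α θ μ c c' r : ℝ}
    (hμ0 : 0 ≤ μ) (hμ1 : μ ≤ 1)
    (hc : c = (1 + θ - μ) * α - θ) (hc' : c' = (1 + θ - μ) * α ^ 2 - θ)
    (hr1 : |α * c / v| * r * r ≤ 1)
    (hr2 : (α * c / v) ^ 2 * r ^ 2 ≤ (c' - c ^ 2) / (2 * v))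
    {π x : M → ℝ} (hπ : ∀ b, 0 ≤ π b) (hπ1 : ∑ b, π b = 1)
    (hx0 : ∑ b, π b * x b = 0) (hx : ∀ b, |x b| ≤ r) (m : ℝ) (b : M) :
    ∫⁻ y, ENNReal.ofReal (gaussianPDFReal (m + α * x b) v y ^ (1 + θ - μ) *
      gaussianPDFReal (m + x b) v y ^ (-θ) *
      (∑ b', π b' * gaussianPDFReal (m + α * x b') v y) ^ μ) ≤ 1 := by
  set q := (c ^ 2 - c') / (2 * v) with hq
  set s := α * c / v with hs
  have hpos : ∀ m y : ℝ, 0 < gaussianPDFReal m v y := fun m y => gaussianPDFReal_pos m v y hv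
  have hq0 : q + s ^ 2 * r ^ 2 ≤ 0 := by
    have : q = - ((c' - c ^ 2) / (2 * v)) := by rw [hq]; ring
    linarith
  have hqneg : q ≤ 0 := by nlinarith [sq_nonneg (s * r)]
  have hpt : ∀ y, gaussianPDFReal (m + α * x b) v y ^ (1 + θ - μ) *
      gaussianPDFReal (m + x b) v y ^ (-θ) *
      (∑ b', π b' * gaussianPDFReal (m + α * x b') v y) ^ μ ≤
      (1 - μ) * Real.exp (q * x b ^ 2) * gaussianPDFReal (m + c * x b) v y +
      ∑ b', μ * π b' * Real.exp (q * x b ^ 2 + s * (x b * x b')) *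
        gaussianPDFReal (m + c * x b + α * x b') v y := by
    intro y
    set A := gaussianPDFReal (m + α * x b) v y ^ (1 + θ - μ) *
      gaussianPDFReal (m + x b) v y ^ (-θ) with hA
    set g := gaussianPDFReal m v y with hg
    have hgpos : 0 < g := hpos m y
    have hA0 : 0 < A := mul_pos (Real.rpow_pos_of_pos (hpos _ _) _)
      (Real.rpow_pos_of_pos (hpos _ _) _)
    have hmix : (∑ b', π b' * gaussianPDFReal (m + α * x b') v y) ^ μ ≤
        (1 - μ) * (g ^ (μ - 1) * g) +
          ∑ b', μ * π b' * (g ^ (μ - 1) * gaussianPDFReal (m + α * x b') v y) := by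
      set S := ∑ b', π b' * gaussianPDFReal (m + α * x b') v y with hS
      have hS0 : 0 ≤ S := Finset.sum_nonneg fun b' _ => mul_nonneg (hπ b') (hpos _ _).le
      have h1 := rpow_le_one_sub_add_mul (div_nonneg hS0 hgpos.le) hμ0 hμ1
      rw [Real.div_rpow hS0 hgpos.le, div_le_iff₀ (Real.rpow_pos_of_pos hgpos _)] at h1
      refine h1.trans (le_of_eq ?_)
      have h2 : g ^ μ = g ^ (μ - 1) * g := by
        rw [← Real.rpow_add_one hgpos.ne']; ring_nf
      have h3 : ∑ b', μ * π b' * (g ^ (μ - 1) * gaussianPDFReal (m + α * x b') v y) =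
          μ * g ^ (μ - 1) * S := by
        rw [hS, Finset.mul_sum]; exact Finset.sum_congr rfl fun _ _ => by ring
      rw [h3, h2]; field_simp
    refine (mul_le_mul_of_nonneg_left hmix hA0.le).trans (le_of_eq ?_)
    have h0 := gaussianPDFReal_tilt hv α θ μ c c' m (x b) 0 y hc hc'
    simp only [mul_zero, add_zero] at h0
    rw [← hA, ← hg, ← hq] at h0
    rw [mul_add, Finset.mul_sum]
    congr 1
    · rw [mul_assoc (1 - μ), ← h0]; ring
    · refine Finset.sum_congr rfl fun b' _ => ?_
      have h1 := gaussianPDFReal_tilt hv α θ μ c c' m (x b) (x b') y hc hc'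
      rw [← hA, ← hg, ← hq, ← hs] at h1
      rw [mul_assoc (μ * π b'), ← h1]; ring
  calc _ ≤ ∫⁻ y, (ENNReal.ofReal ((1 - μ) * Real.exp (q * x b ^ 2)) *
          gaussianPDF (m + c * x b) v y +
        ∑ b', ENNReal.ofReal (μ * π b' * Real.exp (q * x b ^ 2 + s * (x b * x b'))) *
          gaussianPDF (m + c * x b + α * x b') v y) := by
        refine lintegral_mono fun y => (ENNReal.ofReal_le_ofReal (hpt y)).trans (le_of_eq ?_)
        have h1 : ∀ b', 0 ≤ μ * π b' * Real.exp (q * x b ^ 2 + s * (x b * x b')) := fun b' =>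
          mul_nonneg (mul_nonneg hμ0 (hπ b')) (Real.exp_pos _).le
        have h2 : 0 ≤ (1 - μ) * Real.exp (q * x b ^ 2) :=
          mul_nonneg (sub_nonneg.2 hμ1) (Real.exp_pos _).le
        rw [ENNReal.ofReal_add (mul_nonneg h2 (hpos _ _).le)
          (Finset.sum_nonneg fun b' _ => mul_nonneg (h1 b') (hpos _ _).le),
          ENNReal.ofReal_sum_of_nonneg fun b' _ => mul_nonneg (h1 b') (hpos _ _).le,
          ENNReal.ofReal_mul h2]
        congr 1
        exact Finset.sum_congr rfl fun b' _ => ENNReal.ofReal_mul (h1 b')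
    _ = ENNReal.ofReal ((1 - μ) * Real.exp (q * x b ^ 2) +
        ∑ b', μ * π b' * Real.exp (q * x b ^ 2 + s * (x b * x b'))) := by
        have h1 : ∀ b', 0 ≤ μ * π b' * Real.exp (q * x b ^ 2 + s * (x b * x b')) := fun b' =>
          mul_nonneg (mul_nonneg hμ0 (hπ b')) (Real.exp_pos _).le
        have h2 : 0 ≤ (1 - μ) * Real.exp (q * x b ^ 2) :=
          mul_nonneg (sub_nonneg.2 hμ1) (Real.exp_pos _).le
        rw [lintegral_add_left ((measurable_gaussianPDF _ _).const_mul _),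
          lintegral_finsetSum _ fun b' _ => (measurable_gaussianPDF _ _).const_mul _,
          lintegral_const_mul _ (measurable_gaussianPDF _ _), lintegral_gaussianPDF_eq_one _ hv,
          ENNReal.ofReal_add h2 (Finset.sum_nonneg fun b' _ => h1 b'),
          ENNReal.ofReal_sum_of_nonneg fun b' _ => h1 b', mul_one]
        congr 1
        refine Finset.sum_congr rfl fun b' _ => ?_
        rw [lintegral_const_mul _ (measurable_gaussianPDF _ _), lintegral_gaussianPDF_eq_one _ hv,
          mul_one]
    _ ≤ ENNReal.ofReal 1 := by
        refine ENNReal.ofReal_le_ofReal ?_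
        have h3 : ∑ b', π b' * Real.exp ((s * x b) * x b') ≤ Real.exp ((s * x b) ^ 2 * r ^ 2) := by
          refine sum_mul_exp_le hπ hπ1 hx0 hx ?_
          rw [abs_mul]
          have hr0 : 0 ≤ r := (abs_nonneg _).trans (hx b)
          refine le_trans ?_ hr1
          gcongr
          exact hx b
        have h4 : ∑ b', μ * π b' * Real.exp (q * x b ^ 2 + s * (x b * x b')) =
            μ * Real.exp (q * x b ^ 2) * ∑ b', π b' * Real.exp ((s * x b) * x b') := by
          rw [Finset.mul_sum]
          refine Finset.sum_congr rfl fun b' _ => ?_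
          rw [Real.exp_add]; ring_nf
        have h5 : Real.exp (q * x b ^ 2) ≤ 1 :=
          Real.exp_le_one_iff.2 (mul_nonpos_of_nonpos_of_nonneg hqneg (sq_nonneg _))
        have h6 : Real.exp (q * x b ^ 2) * ∑ b', π b' * Real.exp ((s * x b) * x b') ≤ 1 := by
          calc _ ≤ Real.exp (q * x b ^ 2) * Real.exp ((s * x b) ^ 2 * r ^ 2) := by gcongr
            _ = Real.exp ((q + s ^ 2 * r ^ 2) * x b ^ 2) := by rw [← Real.exp_add]; ring_nf
            _ ≤ 1 := Real.exp_le_one_iff.2 (mul_nonpos_of_nonpos_of_nonneg hq0 (sq_nonneg _))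
        rw [h4, mul_assoc μ]
        nlinarith [mul_le_mul_of_nonneg_left h5 (sub_nonneg.2 hμ1),
          mul_le_mul_of_nonneg_left h6 hμ0]
    _ = 1 := ENNReal.ofReal_one

end GaussianStep

section SmallSignal

variable {M : Type*} [Fintype M]

lemma tiltedMoment_nonneg {θ μ : ℝ} {a p : M → ℝ} (ha : ∀ b, 0 < a b) (hp : ∀ b, 0 < p b) :
    0 ≤ tiltedMoment θ μ a p :=
  Finset.sum_nonneg fun b _ => mul_nonneg (mul_nonneg (Real.rpow_nonneg (ha b).le _)
    (Real.rpow_nonneg (hp b).le _)) (Real.rpow_nonneg (Finset.sum_nonneg fun b _ => (ha b).le) _)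

lemma measurable_tiltedMoment_mul {Ω : Type*} [MeasurableSpace Ω] (θ μ : ℝ) (a p : M → ℝ)
    {k l : M → Ω → ℝ} (hk : ∀ b, Measurable (k b)) (hl : ∀ b, Measurable (l b)) :
    Measurable fun y => tiltedMoment θ μ (fun b => a b * k b y) (fun b => p b * l b y) := by
  unfold tiltedMoment
  exact Finset.measurable_sum _ fun b _ => ((((hk b).const_mul _).pow_const _).mul
    (((hl b).const_mul _).pow_const _)).mul
      ((Finset.measurable_sum _ fun b' _ => (hk b').const_mul _).pow_const _)

lemma preservesDomination_of_abs_le {v : ℝ≥0} (hv : v ≠ 0) {α θ μ c c' r : ℝ}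
    (hμ0 : 0 ≤ μ) (hμ1 : μ ≤ 1)
    (hc : c = (1 + θ - μ) * α - θ) (hc' : c' = (1 + θ - μ) * α ^ 2 - θ)
    (hr1 : |α * c / v| * r * r ≤ 1)
    (hr2 : (α * c / v) ^ 2 * r ^ 2 ≤ (c' - c ^ 2) / (2 * v))
    {s : M → ℝ} (hs : ∀ b, |s b| ≤ r / 2) :
    PreservesDomination θ μ (fun b y => gaussianPDFReal (α * s b) v y)
      (fun b y => gaussianPDFReal (s b) v y) := by
  intro U V hU hV hUV a p ha hp
  have hpos : ∀ m y : ℝ, 0 < gaussianPDFReal m v y := fun m y => gaussianPDFReal_pos m v y hv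
  set A := ∑ b, a b with hA
  set xh := (∑ b, a b * s b) / A with hxh
  have hshift : outputValue (fun b y => gaussianPDFReal (s b) v y) V p =
      ∫⁻ y, V (fun b => p b * gaussianPDFReal (α * xh + (s b - xh)) v y) := by
    unfold outputValue
    rw [← lintegral_add_right_eq_self (μ := (volume : Measure ℝ)) _ ((1 - α) * xh)]
    refine lintegral_congr fun y => ?_
    congr 1
    funext b
    simp only [gaussianPDFReal]
    ring_nf
  have hUm : ∀ y, U (fun b => a b * gaussianPDFReal (α * s b) v y) ≤
      V (fun b => p b * gaussianPDFReal (α * xh + (s b - xh)) v y) +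
      ENNReal.ofReal (tiltedMoment θ μ (fun b => a b * gaussianPDFReal (α * s b) v y)
        (fun b => p b * gaussianPDFReal (α * xh + (s b - xh)) v y)) := fun y =>
    hUV _ _ (fun b => mul_pos (ha b) (hpos _ _)) (fun b => mul_pos (hp b) (hpos _ _))
  rw [hshift]
  refine (lintegral_mono hUm).trans ?_
  rw [lintegral_add_right _ (measurable_tiltedMoment_mul θ μ a p
    (fun b => measurable_gaussianPDFReal _ _)
    (fun b => measurable_gaussianPDFReal _ _)).ennreal_ofReal]
  gcongr
  have hterm : ∀ y, ENNReal.ofReal (tiltedMoment θ μ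
      (fun b => a b * gaussianPDFReal (α * s b) v y)
      (fun b => p b * gaussianPDFReal (α * xh + (s b - xh)) v y)) =
      ∑ b, ENNReal.ofReal (a b ^ (1 + θ - μ) * p b ^ (-θ) * A ^ μ) *
        ENNReal.ofReal (gaussianPDFReal (α * xh + α * (s b - xh)) v y ^ (1 + θ - μ) *
          gaussianPDFReal (α * xh + (s b - xh)) v y ^ (-θ) *
          (∑ b', a b' / A * gaussianPDFReal (α * xh + α * (s b' - xh)) v y) ^ μ) := by
    intro y
    unfold tiltedMoment
    rw [ENNReal.ofReal_sum_of_nonneg]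
    · refine Finset.sum_congr rfl fun b _ => ?_
      have hA0 : 0 < A := (ha b).trans_le (Finset.single_le_sum (fun b _ => (ha b).le)
        (Finset.mem_univ b))
      have hc0 : 0 ≤ a b ^ (1 + θ - μ) * p b ^ (-θ) * A ^ μ :=
        mul_nonneg (mul_nonneg (Real.rpow_nonneg (ha b).le _) (Real.rpow_nonneg (hp b).le _))
          (Real.rpow_nonneg hA0.le _)
      rw [← ENNReal.ofReal_mul hc0]
      congr 1
      have e1 : ∀ b, α * xh + α * (s b - xh) = α * s b := fun b => by ring
      have e2 : ∑ b', a b' * gaussianPDFReal (α * s b') v y =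
          A * ∑ b', a b' / A * gaussianPDFReal (α * s b') v y := by
        rw [Finset.mul_sum]
        refine Finset.sum_congr rfl fun b' _ => ?_
        field_simp
      simp only [e1]
      rw [e2, Real.mul_rpow (ha b).le (hpos _ _).le, Real.mul_rpow (hp b).le (hpos _ _).le,
        Real.mul_rpow hA0.le (Finset.sum_nonneg fun b' _ =>
          mul_nonneg (div_nonneg (ha b').le hA0.le) (hpos _ _).le)]
      ring
    · intro b _
      have : 0 ≤ ∑ b', a b' * gaussianPDFReal (α * s b') v y :=
        Finset.sum_nonneg fun b' _ => mul_nonneg (ha b').le (hpos _ _).le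
      have := mul_pos (ha b) (hpos (α * s b) y)
      have := mul_pos (hp b) (hpos (α * xh + (s b - xh)) y)
      positivity
  simp only [hterm]
  have hmeas : ∀ b : M, Measurable fun y => ENNReal.ofReal
      (gaussianPDFReal (α * xh + α * (s b - xh)) v y ^ (1 + θ - μ) *
          gaussianPDFReal (α * xh + (s b - xh)) v y ^ (-θ) *
          (∑ b', a b' / A * gaussianPDFReal (α * xh + α * (s b' - xh)) v y) ^ μ) := fun b =>
    ((((measurable_gaussianPDFReal _ _).pow_const _).mul
      ((measurable_gaussianPDFReal _ _).pow_const _)).mul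
      ((Finset.measurable_sum _ fun b' _ =>
        (measurable_gaussianPDFReal _ _).const_mul _).pow_const _)).ennreal_ofReal
  rw [lintegral_finsetSum _ fun b _ => (hmeas b).const_mul _, tiltedMoment,
    ENNReal.ofReal_sum_of_nonneg fun b _ => mul_nonneg (mul_nonneg (Real.rpow_nonneg (ha b).le _)
      (Real.rpow_nonneg (hp b).le _))
      (Real.rpow_nonneg (Finset.sum_nonneg fun b _ => (ha b).le) _)]
  refine Finset.sum_le_sum fun b _ => ?_
  rw [lintegral_const_mul _ (hmeas b)]
  have hA0 : 0 < A := (ha b).trans_le (Finset.single_le_sum (fun b _ => (ha b).le)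
    (Finset.mem_univ b))
  have hsum : ∑ b, a b / A = 1 := by rw [← Finset.sum_div]; exact div_self hA0.ne'
  have hxabs : |xh| ≤ r / 2 := by
    rw [hxh, abs_div, abs_of_pos hA0, div_le_iff₀ hA0, hA, Finset.mul_sum]
    refine (Finset.abs_sum_le_sum_abs _ _).trans (Finset.sum_le_sum fun b _ => ?_)
    rw [abs_mul, abs_of_pos (ha b), mul_comm]
    exact mul_le_mul_of_nonneg_right (hs b) (ha b).le
  refine (mul_le_mul_right (lintegral_tilted_mixture_le hv hμ0 hμ1 hc hc' hr1 hr2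
    (π := fun b => a b / A) (x := fun b => s b - xh) (fun b => (div_pos (ha b) hA0).le) hsum
    ?_ ?_ (α * xh) b) _).trans (by rw [mul_one])
  · simp only [mul_sub]
    rw [Finset.sum_sub_distrib, ← Finset.sum_mul, hsum, hxh, Finset.sum_div]
    simp only [one_mul, sub_eq_zero]
    exact Finset.sum_congr rfl fun b _ => by ring
  · intro b
    have := abs_sub (s b) xh
    linarith [hs b]

end SmallSignal

section Splitting

variable {M : Type*}

lemma gaussianPDFReal_mul_rotate (v : ℝ≥0) (u y z : ℝ) :
    gaussianPDFReal u v y * gaussianPDFReal u v z =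
      gaussianPDFReal 0 v ((y - z) / √2) * gaussianPDFReal (√2 * u) v ((y + z) / √2) := by
  have h2 : (√2 : ℝ) ^ 2 = 2 := Real.sq_sqrt (by norm_num)
  have h0 : (√2 : ℝ) ≠ 0 := by positivity
  simp only [gaussianPDFReal]
  rw [mul_mul_mul_comm, ← Real.exp_add, mul_mul_mul_comm, ← Real.exp_add]
  congr 2
  have : (y + z) / √2 - √2 * u = (y + z - 2 * u) / √2 := by
    field_simp; rw [h2]; ring
  rw [this, sub_zero, div_pow, div_pow, h2]
  ring

lemma lintegral_comp_const_mul {f : ℝ → ℝ≥0∞} (hf : Measurable f) {c : ℝ} (hc : 0 < c) :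
    ∫⁻ x, f (c * x) = ENNReal.ofReal c⁻¹ * ∫⁻ x, f x := by
  rw [← lintegral_map hf (measurable_const_mul c), Real.map_volume_mul_left hc.ne',
    lintegral_smul_measure, abs_of_pos (inv_pos.2 hc), smul_eq_mul]

/-- Two observations of the same scalar signal are one observation of the rotated signal. -/
lemma outputValue_outputValue_gaussian {v : ℝ≥0} (hv : v ≠ 0) {U : (M → ℝ) → ℝ≥0∞}
    (hU : IsGauge U) (u : M → ℝ) :
    outputValue (fun b y => gaussianPDFReal (u b) v y)
        (outputValue (fun b y => gaussianPDFReal (u b) v y) U) =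
      outputValue (fun b y => gaussianPDFReal (√2 * u b) v y) U := by
  funext a
  have h2 : (√2 : ℝ) * √2 = 2 := Real.mul_self_sqrt (by norm_num)
  have h0 : (0 : ℝ) < √2 := by positivity
  set H : ℝ → ℝ≥0∞ := fun z => U (fun b => a b * gaussianPDFReal (√2 * u b) v z) with hH
  have hHm : Measurable H := hU.measurable.comp (measurable_pi_lambda _ fun b =>
    (measurable_gaussianPDFReal _ _).const_mul _)
  have hpt : ∀ y z, U (fun b => a b * gaussianPDFReal (u b) v y * gaussianPDFReal (u b) v z) =
      gaussianPDF 0 v ((y - z) / √2) * H ((y + z) / √2) := by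
    intro y z
    rw [hH, gaussianPDF, ← hU.homogeneous _ (gaussianPDFReal_pos _ _ _ hv)]
    congr 1
    funext b
    rw [mul_assoc, gaussianPDFReal_mul_rotate]
    ring
  calc _ = ∫⁻ y, ∫⁻ z, gaussianPDF 0 v ((y - z) / √2) * H ((y + z) / √2) := by
        simp only [outputValue, hpt]
    _ = ∫⁻ y, ∫⁻ z, gaussianPDF 0 v (√2 * y - z / √2) * H (z / √2) := by
        refine lintegral_congr fun y => ?_
        rw [← lintegral_add_right_eq_self (μ := (volume : Measure ℝ)) _ (-y)]
        refine lintegral_congr fun z => ?_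
        congr 2
        · field_simp; rw [pow_two, h2]; ring
        · ring
    _ = ∫⁻ z, ∫⁻ y, gaussianPDF 0 v (√2 * y - z / √2) * H (z / √2) := by
        refine lintegral_lintegral_swap (Measurable.aemeasurable ?_)
        exact ((measurable_gaussianPDF 0 v).comp (by fun_prop)).mul (hHm.comp (by fun_prop))
    _ = ∫⁻ z, ENNReal.ofReal (√2)⁻¹ * H ((√2)⁻¹ * z) := by
        refine lintegral_congr fun z => ?_
        rw [lintegral_mul_const _ (show Measurable fun y => gaussianPDF 0 v (√2 * y - z / √2) from
            (measurable_gaussianPDF 0 v).comp (by fun_prop)),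
          lintegral_comp_const_mul (f := fun y => gaussianPDF 0 v (y - z / √2))
            ((measurable_gaussianPDF 0 v).comp (by fun_prop)) h0,
          lintegral_sub_right_eq_self (fun y => gaussianPDF 0 v y),
          lintegral_gaussianPDF_eq_one _ hv, mul_one, div_eq_inv_mul]
    _ = ∫⁻ z, H z := by
        rw [lintegral_const_mul _ (show Measurable fun z => H ((√2)⁻¹ * z) from
            hHm.comp (by fun_prop)),
          lintegral_comp_const_mul hHm (inv_pos.2 h0), ← mul_assoc,
          ← ENNReal.ofReal_mul (by positivity), inv_inv, inv_mul_cancel₀ h0.ne',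
          ENNReal.ofReal_one, one_mul]

lemma PreservesDomination.sqrt_two_mul [Fintype M] {v : ℝ≥0} (hv : v ≠ 0) {α θ μ : ℝ} {u : M → ℝ}
    (h : PreservesDomination θ μ (fun b y => gaussianPDFReal (α * u b) v y)
      (fun b y => gaussianPDFReal (u b) v y)) :
    PreservesDomination θ μ (fun b y => gaussianPDFReal (α * (√2 * u b)) v y)
      (fun b y => gaussianPDFReal (√2 * u b) v y) := by
  intro U V hU hV hUV
  have h1 := h _ _ (hU.outputValue fun b => measurable_gaussianPDFReal _ _)
    (hV.outputValue fun b => measurable_gaussianPDFReal _ _) (h U V hU hV hUV)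
  rw [outputValue_outputValue_gaussian hv hU, outputValue_outputValue_gaussian hv hV] at h1
  simpa only [mul_left_comm α] using h1

lemma preservesDomination_gaussian [Fintype M] {v : ℝ≥0} (hv : v ≠ 0) {α θ μ c c' : ℝ}
    (hμ0 : 0 ≤ μ) (hμ1 : μ ≤ 1)
    (hc : c = (1 + θ - μ) * α - θ) (hc' : c' = (1 + θ - μ) * α ^ 2 - θ) (hcc : c ^ 2 < c')
    (s : M → ℝ) :
    PreservesDomination θ μ (fun b y => gaussianPDFReal (α * s b) v y)
      (fun b y => gaussianPDFReal (s b) v y) := by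
  have hv' : (0 : ℝ) < v := by exact_mod_cast pos_iff_ne_zero.2 hv
  obtain ⟨r, hr0, hr1, hr2⟩ : ∃ r : ℝ, 0 < r ∧ |α * c / v| * r * r ≤ 1 ∧
      (α * c / v) ^ 2 * r ^ 2 ≤ (c' - c ^ 2) / (2 * v) := by
    have t1 : Filter.Tendsto (fun r : ℝ => |α * c / v| * r * r) (nhdsWithin 0 (Set.Ioi 0))
        (nhds (|α * c / v| * 0 * 0)) :=
      (Continuous.tendsto (by fun_prop) 0).mono_left nhdsWithin_le_nhds
    have t2 : Filter.Tendsto (fun r : ℝ => (α * c / v) ^ 2 * r ^ 2) (nhdsWithin 0 (Set.Ioi 0))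
        (nhds ((α * c / v) ^ 2 * 0 ^ 2)) :=
      (Continuous.tendsto (by fun_prop) 0).mono_left nhdsWithin_le_nhds
    have e1 := t1.eventually_le_const (u := 1) (by norm_num)
    have e2 := t2.eventually_le_const (u := (c' - c ^ 2) / (2 * v)) (by
      have : 0 < (c' - c ^ 2) / (2 * v) := div_pos (sub_pos.2 hcc) (by positivity)
      simpa using this)
    obtain ⟨r, h⟩ := (e1.and (e2.and self_mem_nhdsWithin)).exists
    exact ⟨r, h.2.2, h.1, h.2.1⟩
  have key : ∀ (K : ℕ) (s : M → ℝ), (∀ b, |s b| ≤ r / 2 * √2 ^ K) →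
      PreservesDomination θ μ (fun b y => gaussianPDFReal (α * s b) v y)
        (fun b y => gaussianPDFReal (s b) v y) := by
    intro K
    induction K with
    | zero =>
      intro s hs
      exact preservesDomination_of_abs_le hv hμ0 hμ1 hc hc' hr1 hr2 (by simpa using hs)
    | succ K ih =>
      intro s hs
      have h0 : (0 : ℝ) < √2 := by positivity
      have := (ih (fun b => s b / √2) fun b => by
        rw [abs_div, abs_of_pos h0, div_le_iff₀ h0, mul_assoc, ← pow_succ]
        exact hs b).sqrt_two_mul hv
      simpa only [mul_div_cancel₀ _ h0.ne'] using this
  have hK : ∀ b, ∃ K : ℕ, |s b| ≤ r / 2 * √2 ^ K := by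
    intro b
    obtain ⟨K, hK⟩ := pow_unbounded_of_one_lt (|s b| / (r / 2)) Real.one_lt_sqrt_two
    refine ⟨K, ?_⟩
    rw [div_lt_iff₀ (by positivity)] at hK
    linarith
  choose K hK using hK
  refine key (∑ b, K b) s fun b => (hK b).trans ?_
  have h1 : (1 : ℝ) ≤ √2 := Real.one_lt_sqrt_two.le
  gcongr
  exact Finset.single_le_sum (fun _ _ => Nat.zero_le _) (Finset.mem_univ b)

/-- Scaling the signal of a vector Gaussian channel by `α` preserves domination. -/
lemma preservesDomination_gaussian_pi [Fintype M] {v : ℝ≥0} (hv : v ≠ 0) {α θ μ c c' : ℝ}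
    (hμ0 : 0 ≤ μ) (hμ1 : μ ≤ 1)
    (hc : c = (1 + θ - μ) * α - θ) (hc' : c' = (1 + θ - μ) * α ^ 2 - θ) (hcc : c ^ 2 < c')
    {n J : ℕ} (s : M → Fin n → Fin J → ℝ) :
    PreservesDomination θ μ
      (fun b (y : Fin n → Fin J → ℝ) => ∏ j, ∏ i, gaussianPDFReal (α * s b j i) v (y j i))
      (fun b (y : Fin n → Fin J → ℝ) => ∏ j, ∏ i, gaussianPDFReal (s b j i) v (y j i)) := by
  have hm : ∀ w : Fin J → ℝ, Measurable fun y : Fin J → ℝ => ∏ i, gaussianPDFReal (w i) v (y i) :=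
    fun w => Finset.measurable_prod _ fun i _ =>
      (measurable_gaussianPDFReal _ _).comp (measurable_pi_apply i)
  have h1 : ∀ j, PreservesDomination θ μ
      (fun b (y : Fin J → ℝ) => ∏ i, gaussianPDFReal (α * s b j i) v (y i))
      (fun b (y : Fin J → ℝ) => ∏ i, gaussianPDFReal (s b j i) v (y i)) := fun j =>
    PreservesDomination.pi (k := fun i b y => gaussianPDFReal (α * s b j i) v y)
      (l := fun i b y => gaussianPDFReal (s b j i) v y)
      (fun i b => measurable_gaussianPDFReal _ _) (fun i b => measurable_gaussianPDFReal _ _)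
      fun i => preservesDomination_gaussian hv hμ0 hμ1 hc hc' hcc (fun b => s b j i)
  exact PreservesDomination.pi (Ω := Fin J → ℝ)
    (k := fun j b y => ∏ i, gaussianPDFReal (α * s b j i) v (y i))
    (l := fun j b y => ∏ i, gaussianPDFReal (s b j i) v (y i))
    (fun j b => hm _) (fun j b => hm _) h1

end Splitting

section BitDecision

variable {M : Type*} [Fintype M]

/-- The total weight of the messages whose distinguished bit is `c`. -/
def bitWeight (β : M → Bool) (c : Bool) (a : M → ℝ) : ℝ := ∑ b, if β b = c then a b else 0

/-- The weight of the less likely value of the distinguished bit. -/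
noncomputable def bitRisk (β : M → Bool) (a : M → ℝ) : ℝ≥0∞ :=
  ENNReal.ofReal (min (bitWeight β true a) (bitWeight β false a))

/-- The unnormalized error of the decision rule `D` for the bit `β` when message `b` produces an
output of density `k b`. -/
noncomputable def errorMass {Ω : Type*} [MeasureSpace Ω] (k : M → Ω → ℝ) (β : M → Bool)
    (D : Ω → Bool) : ℝ≥0∞ :=
  ∑ b, ∫⁻ y, if D y ≠ β b then ENNReal.ofReal (k b y) else 0

lemma measurable_bitWeight (β : M → Bool) (c : Bool) : Measurable (bitWeight β c) := by
  unfold bitWeight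
  refine Finset.measurable_sum _ fun b _ => ?_
  split_ifs
  · exact measurable_pi_apply b
  · exact measurable_const

lemma bitWeight_nonneg (β : M → Bool) (c : Bool) {a : M → ℝ} (ha : ∀ b, 0 ≤ a b) :
    0 ≤ bitWeight β c a :=
  Finset.sum_nonneg fun b _ => by split_ifs; exacts [ha b, le_rfl]

lemma isGauge_bitRisk (β : M → Bool) : IsGauge (bitRisk β) := by
  refine ⟨((measurable_bitWeight β true).min (measurable_bitWeight β false)).ennreal_ofReal,
    fun r hr a => ?_⟩
  have h : ∀ c, bitWeight β c (fun b => r * a b) = r * bitWeight β c a := fun c => by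
    simp only [bitWeight, Finset.mul_sum, mul_ite, mul_zero]
  rw [bitRisk, bitRisk, h, h, ← mul_min_of_nonneg _ _ hr.le, ENNReal.ofReal_mul hr.le]

lemma sum_ite_ne_eq_bitWeight (β : M → Bool) {a : M → ℝ} (ha : ∀ b, 0 ≤ a b) (c : Bool) :
    (∑ b, if c ≠ β b then ENNReal.ofReal (a b) else 0) = ENNReal.ofReal (bitWeight β (!c) a) := by
  rw [bitWeight, ENNReal.ofReal_sum_of_nonneg fun b _ => by split_ifs; exacts [ha b, le_rfl]]
  refine Finset.sum_congr rfl fun b _ => ?_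
  cases c <;> cases β b <;> simp

lemma dominated_bitRisk {θ μ : ℝ} (hθ : 0 ≤ θ) (hμ : 0 ≤ μ) (β : M → Bool) :
    Dominated θ μ (bitRisk β) (bitRisk β) := by
  intro a p ha hp
  have hT : ∀ c, bitWeight β c a ≤ bitWeight β c p + tiltedMoment θ μ a p := by
    intro c
    rw [bitWeight, bitWeight, tiltedMoment, ← Finset.sum_add_distrib]
    refine Finset.sum_le_sum fun b _ => ?_
    have hA : a b ≤ ∑ b', a b' := Finset.single_le_sum (fun b _ => (ha b).le) (Finset.mem_univ b)
    have hA0 := (ha b).trans_le hA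
    have hnn : 0 ≤ a b ^ (1 + θ - μ) * p b ^ (-θ) * (∑ b', a b') ^ μ := by
      have := ha b; have := hp b; positivity
    split_ifs
    · rcases le_total (a b) (p b) with h | h
      · linarith
      · have h1 : a b = a b ^ (1 + θ - μ) * a b ^ (-θ) * a b ^ μ := by
          rw [← Real.rpow_add (ha b), ← Real.rpow_add (ha b)]
          ring_nf
          rw [Real.rpow_one]
        have h2 : a b ^ (1 + θ - μ) * a b ^ (-θ) * a b ^ μ ≤
            a b ^ (1 + θ - μ) * p b ^ (-θ) * (∑ b', a b') ^ μ := by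
          have := ha b; have := hp b
          refine mul_le_mul (mul_le_mul_of_nonneg_left
            (Real.rpow_le_rpow_of_nonpos (hp b) h (neg_nonpos.2 hθ)) (by positivity))
            (Real.rpow_le_rpow (ha b).le hA hμ) (by positivity) (by positivity)
        linarith [hp b]
    · linarith
  rw [bitRisk, bitRisk, ← ENNReal.ofReal_add
    (le_min (bitWeight_nonneg β true fun b => (hp b).le)
      (bitWeight_nonneg β false fun b => (hp b).le))
    (tiltedMoment_nonneg ha hp)]
  refine ENNReal.ofReal_le_ofReal ?_
  rw [← min_add_add_right]
  exact min_le_min (hT true) (hT false)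

variable {Ω : Type*} [MeasureSpace Ω]

lemma errorMass_eq_lintegral {k : M → Ω → ℝ} (hk : ∀ b, Measurable (k b)) (hk0 : ∀ b y, 0 ≤ k b y)
    (β : M → Bool) {D : Ω → Bool} (hD : Measurable D) :
    errorMass k β D = ∫⁻ y, ENNReal.ofReal (bitWeight β (!D y) fun b => k b y) := by
  rw [errorMass, ← lintegral_finsetSum]
  · exact lintegral_congr fun y => sum_ite_ne_eq_bitWeight β (fun b => hk0 b y) (D y)
  · intro b _
    exact Measurable.ite (hD (MeasurableSet.of_discrete (s := {c | c ≠ β b})))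
      (hk b).ennreal_ofReal measurable_const

lemma outputValue_bitRisk_le {l : M → Ω → ℝ} (hl : ∀ b, Measurable (l b))
    (hl0 : ∀ b y, 0 ≤ l b y) (β : M → Bool) {D : Ω → Bool} (hD : Measurable D) {t : ℝ}
    (ht : 0 < t) :
    outputValue l (bitRisk β) (fun _ => t) ≤ ENNReal.ofReal t * errorMass l β D := by
  rw [errorMass_eq_lintegral hl hl0 β hD, ← lintegral_const_mul' _ _ ENNReal.ofReal_ne_top,
    outputValue]
  refine lintegral_mono fun y => ?_
  dsimp only
  rw [(isGauge_bitRisk β).homogeneous t ht]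
  gcongr
  refine ENNReal.ofReal_le_ofReal ?_
  cases D y
  · exact min_le_left _ _
  · exact min_le_right _ _

/-- The maximum a posteriori rule attains the risk `outputValue k (bitRisk β)`. -/
lemma exists_errorMass_eq {k : M → Ω → ℝ} (hk : ∀ b, Measurable (k b))
    (hk0 : ∀ b y, 0 ≤ k b y) (β : M → Bool) :
    ∃ D : Ω → Bool, Measurable D ∧ errorMass k β D = outputValue k (bitRisk β) fun _ => 1 := by
  classical
  have hm : ∀ c, Measurable fun y => bitWeight β c fun b => k b y := fun c =>
    (measurable_bitWeight β c).comp (measurable_pi_lambda _ hk)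
  refine ⟨fun y => if bitWeight β false (fun b => k b y) ≤ bitWeight β true (fun b => k b y)
    then true else false, Measurable.ite (measurableSet_le (hm _) (hm _)) measurable_const
    measurable_const, ?_⟩
  rw [errorMass_eq_lintegral hk hk0 β (Measurable.ite (measurableSet_le (hm _) (hm _))
    measurable_const measurable_const), outputValue]
  refine lintegral_congr fun y => ?_
  simp only [one_mul, bitRisk]
  congr 1
  split_ifs with h
  · exact (min_eq_right h).symm
  · exact (min_eq_left (not_le.1 h).le).symm

/-- If `l → k` preserves domination, then a decoder for `l` yields a decoder for `k` that may use
the side information `pre`, with controlled loss. -/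
lemma exists_errorMass_le_of_preservesDomination {C : Type*} [Fintype C] [DecidableEq C]
    {k l : M → Ω → ℝ} (hk : ∀ b, Measurable (k b)) (hk0 : ∀ b y, 0 ≤ k b y)
    (hl : ∀ b, Measurable (l b)) (hl0 : ∀ b y, 0 ≤ l b y)
    {θ μ t : ℝ} (hθ : 0 ≤ θ) (hμ : 0 ≤ μ) (ht : 0 < t) (pre : M → C) (β : M → Bool) (m : ℕ)
    (hm : ∀ c, Fintype.card {b // pre b = c} ≤ m)
    (h : ∀ c, PreservesDomination θ μ (fun b : {b // pre b = c} => k b)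
      (fun b : {b // pre b = c} => l b))
    {D : Ω → Bool} (hD : Measurable D) :
    ∃ D' : C → Ω → Bool, (∀ c, Measurable (D' c)) ∧
      (∑ b, ∫⁻ y, if D' (pre b) y ≠ β b then ENNReal.ofReal (k b y) else 0) ≤
        ENNReal.ofReal t * errorMass l β D +
          ENNReal.ofReal (Fintype.card M * (t ^ (-θ) * m ^ μ)) := by
  have hc : ∀ c, ∃ D' : Ω → Bool, Measurable D' ∧
      errorMass (fun b : {b // pre b = c} => k b) (fun b => β b) D' ≤
      ENNReal.ofReal t * errorMass (fun b : {b // pre b = c} => l b) (fun b => β b) D +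
        ENNReal.ofReal (Fintype.card {b // pre b = c} * (t ^ (-θ) * m ^ μ)) := by
    intro c
    obtain ⟨D', hD', he⟩ := exists_errorMass_eq (k := fun b : {b // pre b = c} => k b)
      (fun b => hk b) (fun b => hk0 b) (fun b => β b)
    refine ⟨D', hD', ?_⟩
    rw [he]
    refine (h c _ _ (isGauge_bitRisk _) (isGauge_bitRisk _) (dominated_bitRisk hθ hμ _)
      (fun _ => 1) (fun _ => t) (fun _ => one_pos) (fun _ => ht)).trans ?_
    refine add_le_add (outputValue_bitRisk_le (l := fun b : {b // pre b = c} => l b)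
      (fun b => hl b) (fun b => hl0 b) _ hD ht)
      (ENNReal.ofReal_le_ofReal ?_)
    simp only [tiltedMoment, Real.one_rpow, one_mul, Finset.sum_const, Finset.card_univ,
      nsmul_eq_mul, mul_one]
    have : ((Fintype.card {b // pre b = c} : ℕ) : ℝ) ≤ m := by exact_mod_cast hm c
    gcongr
  choose D' hD' hle using hc
  refine ⟨D', hD', ?_⟩
  rw [← Fintype.sum_fiberwise pre]
  calc _ = ∑ c, errorMass (fun b : {b // pre b = c} => k b) (fun b => β b) (D' c) := by
        refine Finset.sum_congr rfl fun c _ => Finset.sum_congr rfl fun b _ => ?_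
        rw [b.2]
    _ ≤ _ := Finset.sum_le_sum fun c _ => hle c
    _ = _ := by
        rw [Finset.sum_add_distrib, ← Finset.mul_sum, ← ENNReal.ofReal_sum_of_nonneg
          fun c _ => by positivity, ← Finset.sum_mul]
        congr 2
        · simp only [errorMass]
          rw [Fintype.sum_fiberwise pre fun b =>
            ∫⁻ y, if D y ≠ β b then ENNReal.ofReal (l b y) else 0]
        · congr 1
          have := Fintype.sum_fiberwise pre fun _ => (1 : ℝ)
          simpa using this

end BitDecision

section GaussianDensity

lemma lintegral_prod_fin {Ω : Type*} [MeasureSpace Ω] [SigmaFinite (volume : Measure Ω)] {n : ℕ}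
    {f : Fin n → Ω → ℝ≥0∞} (hf : ∀ j, Measurable (f j)) :
    ∫⁻ y : Fin n → Ω, ∏ j, f j (y j) = ∏ j, ∫⁻ y, f j y := by
  induction n with
  | zero => simp [volume_pi]
  | succ n ih =>
    have h : ∫⁻ y : Fin (n + 1) → Ω, ∏ j, f j (y j) =
        ∫⁻ y : Ω × (Fin n → Ω), f 0 y.1 * ∏ j, f (Fin.succ j) (y.2 j) := by
      rw [← (volume_preserving_piFinSuccAbove (fun _ : Fin (n + 1) => Ω) 0).lintegral_comp_emb
        (MeasurableEquiv.measurableEmbedding _)]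
      refine lintegral_congr fun y => ?_
      simp [Fin.prod_univ_succ, MeasurableEquiv.piFinSuccAbove, Fin.tail]
    have hm : Measurable fun y : Fin n → Ω => ∏ j, f (Fin.succ j) (y j) :=
      Finset.measurable_prod _ fun j _ => (hf _).comp (measurable_pi_apply j)
    rw [h, Fin.prod_univ_succ, ← ih fun j => hf _, Measure.volume_eq_prod,
      lintegral_prod_mul (hf 0).aemeasurable hm.aemeasurable]

lemma pi_withDensity_fin {Ω : Type*} [MeasureSpace Ω] [SigmaFinite (volume : Measure Ω)] {n : ℕ}
    {f : Fin n → Ω → ℝ≥0∞} (hf : ∀ j, Measurable (f j))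
    [∀ j, SigmaFinite ((volume : Measure Ω).withDensity (f j))] :
    Measure.pi (fun j => (volume : Measure Ω).withDensity (f j)) =
      (volume : Measure (Fin n → Ω)).withDensity fun y => ∏ j, f j (y j) := by
  refine (Measure.pi_eq fun s hs => ?_)
  rw [withDensity_apply _ (MeasurableSet.univ_pi hs),
    ← lintegral_indicator (MeasurableSet.univ_pi hs)]
  have h : ∀ y : Fin n → Ω, (Set.univ.pi s).indicator (fun y => ∏ j, f j (y j)) y =
      ∏ j, (s j).indicator (f j) (y j) := by
    intro y
    by_cases hy : y ∈ Set.univ.pi s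
    · rw [Set.indicator_of_mem hy]
      exact Finset.prod_congr rfl fun j _ => (Set.indicator_of_mem (hy j trivial) _).symm
    · rw [Set.indicator_of_notMem hy]
      simp only [Set.mem_pi, Set.mem_univ, true_implies, not_forall] at hy
      obtain ⟨j, hj⟩ := hy
      exact (Finset.prod_eq_zero (Finset.mem_univ j) (Set.indicator_of_notMem hj _)).symm
  rw [lintegral_congr h, lintegral_prod_fin fun j => (hf j).indicator (hs j)]
  exact Finset.prod_congr rfl fun j _ => by
    rw [lintegral_indicator (hs j), withDensity_apply _ (hs j)]

variable {n J : ℕ}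

/-- The density at `y` of the output of `n` uses of the `J`-dimensional Gaussian channel with
per-coordinate noise variance `v` and input `x`. -/
noncomputable def gaussianDensity (v : ℝ≥0) (x y : Fin n → Fin J → ℝ) : ℝ :=
  ∏ j, ∏ a, gaussianPDFReal (x j a) v (y j a)

lemma gaussianDensity_pos {v : ℝ≥0} (hv : v ≠ 0) (x y : Fin n → Fin J → ℝ) :
    0 < gaussianDensity v x y :=
  Finset.prod_pos fun _ _ => Finset.prod_pos fun _ _ => gaussianPDFReal_pos _ _ _ hv

lemma measurable_gaussianDensity (v : ℝ≥0) (x : Fin n → Fin J → ℝ) :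
    Measurable (gaussianDensity v x) :=
  Finset.measurable_prod _ fun j _ => Finset.measurable_prod _ fun a _ =>
    (measurable_gaussianPDFReal _ _).comp
      ((measurable_pi_apply a).comp (measurable_pi_apply j))

lemma pi_gaussianReal_eq_withDensity {v : ℝ≥0} (hv : v ≠ 0) (x : Fin n → Fin J → ℝ) :
    (Measure.pi fun j => Measure.pi fun a => gaussianReal (x j a) v) =
      (volume : Measure (Fin n → Fin J → ℝ)).withDensity
        fun y => ENNReal.ofReal (gaussianDensity v x y) := by
  have h1 : ∀ j, (Measure.pi fun a => gaussianReal (x j a) v) =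
      (volume : Measure (Fin J → ℝ)).withDensity fun y => ∏ a, gaussianPDF (x j a) v (y a) := by
    intro j
    have h : ∀ a, SigmaFinite ((volume : Measure ℝ).withDensity (gaussianPDF (x j a) v)) :=
      fun a => by rw [← gaussianReal_of_var_ne_zero _ hv]; infer_instance
    rw [← pi_withDensity_fin fun a => measurable_gaussianPDF _ _]
    simp only [gaussianReal_of_var_ne_zero _ hv]
  have h2 : ∀ j, SigmaFinite ((volume : Measure (Fin J → ℝ)).withDensity
      fun y => ∏ a, gaussianPDF (x j a) v (y a)) := fun j => by rw [← h1]; infer_instance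
  simp only [h1]
  have hm : ∀ j, Measurable fun y : Fin J → ℝ => ∏ a, gaussianPDF (x j a) v (y a) := fun j =>
    Finset.measurable_prod _ fun a _ => (measurable_gaussianPDF _ _).comp (measurable_pi_apply a)
  rw [pi_withDensity_fin hm]
  congr 1
  funext y
  rw [gaussianDensity, ENNReal.ofReal_prod_of_nonneg fun j _ =>
    Finset.prod_nonneg fun a _ => gaussianPDFReal_nonneg _ _ _]
  refine Finset.prod_congr rfl fun j _ => ?_
  rw [ENNReal.ofReal_prod_of_nonneg fun a _ => gaussianPDFReal_nonneg _ _ _]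
  rfl

lemma lintegral_gaussianDensity {v : ℝ≥0} (hv : v ≠ 0) (x : Fin n → Fin J → ℝ) :
    ∫⁻ y, ENNReal.ofReal (gaussianDensity v x y) = 1 := by
  rw [← setLIntegral_univ, ← withDensity_apply _ MeasurableSet.univ,
    ← pi_gaussianReal_eq_withDensity hv]
  exact measure_univ

lemma map_add_pi_gaussianReal (v : ℝ≥0) (x : Fin n → Fin J → ℝ) :
    (Measure.pi fun _ => Measure.pi fun _ => gaussianReal 0 v).map (fun y => x + y) =
      Measure.pi fun j => Measure.pi fun a => gaussianReal (x j a) v := by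
  have h1 : ∀ j, (Measure.pi fun _ : Fin J => gaussianReal 0 v).map (fun y => x j + y) =
      Measure.pi fun a => gaussianReal (x j a) v := by
    intro j
    have := Measure.pi_map_pi (μ := fun _ : Fin J => gaussianReal 0 v)
      (f := fun a y => x j a + y) (fun a => (measurable_const_add _).aemeasurable)
    simp only [gaussianReal_map_const_add, zero_add] at this
    exact this
  have := Measure.pi_map_pi (μ := fun _ : Fin n => Measure.pi fun _ : Fin J => gaussianReal 0 v)
      (f := fun j y => x j + y) (fun j => (measurable_const_add _).aemeasurable)
  simp only [h1] at this
  exact this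

lemma pi_uniform_bool_singleton (b : Fin n → Bool) :
    (Measure.pi fun _ : Fin n => (PMF.uniformOfFintype Bool).toMeasure) {b} = (2 ^ n)⁻¹ := by
  rw [Measure.pi_singleton]
  simp [ENNReal.inv_pow]

lemma bitNoiseMeasure_add_mem {N0 : ℝ} (hN0 : 0 < N0)
    (s : (Fin n → Bool) → Fin n → Fin J → ℝ) {E : (Fin n → Bool) → Set (Fin n → Fin J → ℝ)}
    (hE : ∀ b, MeasurableSet (E b)) :
    bitNoiseMeasure n J N0 {ω | s ω.1 + ω.2 ∈ E ω.1} =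
      (2 ^ n)⁻¹ * ∑ b, ∫⁻ y in E b, ENNReal.ofReal (gaussianDensity (N0 / 2).toNNReal (s b) y) := by
  have hv : (N0 / 2).toNNReal ≠ 0 := (Real.toNNReal_pos.2 (by positivity)).ne'
  have hS : MeasurableSet {ω : (Fin n → Bool) × (Fin n → Fin J → ℝ) | s ω.1 + ω.2 ∈ E ω.1} := by
    have : {ω : (Fin n → Bool) × (Fin n → Fin J → ℝ) | s ω.1 + ω.2 ∈ E ω.1} =
        ⋃ b, {b} ×ˢ ((fun y => s b + y) ⁻¹' E b) := by
      ext ω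
      simp
    rw [this]
    exact MeasurableSet.iUnion fun b =>
      (MeasurableSet.singleton b).prod (measurable_const_add (s b) (hE b))
  rw [bitNoiseMeasure, Measure.prod_apply hS, lintegral_fintype]
  simp only [pi_uniform_bool_singleton]
  rw [← Finset.sum_mul, mul_comm]
  congr 1
  refine Finset.sum_congr rfl fun b _ => ?_
  have : Prod.mk b ⁻¹' {ω : (Fin n → Bool) × (Fin n → Fin J → ℝ) | s ω.1 + ω.2 ∈ E ω.1} =
      (fun y => s b + y) ⁻¹' E b := rfl
  rw [this, ← Measure.map_apply (measurable_const_add _) (hE b), map_add_pi_gaussianReal,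
    pi_gaussianReal_eq_withDensity hv, withDensity_apply _ (hE b)]

lemma measurePreserving_castLE {X : Type*} [MeasurableSpace X] (ν : Measure X)
    [IsProbabilityMeasure ν] {m n : ℕ} (h : m ≤ n) :
    MeasurePreserving (fun (y : Fin n → X) j => y (Fin.castLE h j))
      (Measure.pi fun _ => ν) (Measure.pi fun _ => ν) := by
  have hm : Measurable (fun (y : Fin n → X) j => y (Fin.castLE h j)) :=
    measurable_pi_lambda _ fun j => measurable_pi_apply _
  refine ⟨hm, (Measure.pi_eq fun s hs => ?_).symm⟩
  obtain ⟨k, rfl⟩ := Nat.exists_eq_add_of_le h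
  rw [Measure.map_apply hm (MeasurableSet.univ_pi hs)]
  have : (fun (y : Fin (m + k) → X) j => y (Fin.castLE h j)) ⁻¹' Set.univ.pi s =
      Set.univ.pi (Fin.addCases s fun _ => Set.univ) := by
    ext y
    simp only [Set.mem_preimage, Set.mem_pi, Set.mem_univ, true_implies]
    refine ⟨fun H i => ?_, fun H j => ?_⟩
    · refine Fin.addCases (fun j => ?_) (fun j => ?_) i
      · rw [Fin.addCases_left]
        exact H j
      · simp
    · have := H (Fin.castAdd k j)
      rwa [Fin.addCases_left] at this
  rw [this, Measure.pi_pi, Fin.prod_univ_add]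
  simp

lemma measurePreserving_bitNoiseMeasure {m n J : ℕ} (h : m ≤ n) (N0 : ℝ) :
    MeasurePreserving (fun ω : (Fin n → Bool) × (Fin n → Fin J → ℝ) =>
      ((fun j => ω.1 (Fin.castLE h j), fun j => ω.2 (Fin.castLE h j)) :
        (Fin m → Bool) × (Fin m → Fin J → ℝ)))
      (bitNoiseMeasure n J N0) (bitNoiseMeasure m J N0) :=
  (measurePreserving_castLE _ h).prod (measurePreserving_castLE _ h)

end GaussianDensity

section BlockConverse

variable {n J : ℕ}

lemma gaussianPDFReal_rpow_mul_rpow {v : ℝ≥0} (hv : v ≠ 0) (ρ x y : ℝ) :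
    gaussianPDFReal x v y ^ (1 + ρ) * gaussianPDFReal 0 v y ^ (-ρ) =
      Real.exp (ρ * (1 + ρ) / (2 * v) * x ^ 2) * gaussianPDFReal ((1 + ρ) * x) v y := by
  have hv' : (0 : ℝ) < v := by exact_mod_cast pos_iff_ne_zero.2 hv
  have hZ : 0 < (√(2 * Real.pi * v))⁻¹ := by positivity
  simp only [gaussianPDFReal]
  rw [Real.mul_rpow hZ.le (Real.exp_pos _).le, Real.mul_rpow hZ.le (Real.exp_pos _).le,
    mul_mul_mul_comm, ← Real.rpow_add hZ, ← Real.exp_mul, ← Real.exp_mul, ← Real.exp_add,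
    mul_left_comm, ← Real.exp_add, add_neg_cancel_right, Real.rpow_one]
  congr 2
  field_simp
  ring

lemma lintegral_gaussianDensity_rpow {v : ℝ≥0} (hv : v ≠ 0) (ρ : ℝ) (x : Fin n → Fin J → ℝ) :
    ∫⁻ y, ENNReal.ofReal (gaussianDensity v x y ^ (1 + ρ) * gaussianDensity v 0 y ^ (-ρ)) =
      ENNReal.ofReal (Real.exp (ρ * (1 + ρ) / (2 * v) * ∑ j, ∑ a, x j a ^ 2)) := by
  have h : ∀ y, gaussianDensity v x y ^ (1 + ρ) * gaussianDensity v 0 y ^ (-ρ) =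
      Real.exp (ρ * (1 + ρ) / (2 * v) * ∑ j, ∑ a, x j a ^ 2) *
        gaussianDensity v (fun j a => (1 + ρ) * x j a) y := by
    intro y
    have h0 : ∀ (m : ℝ) (y : ℝ), 0 ≤ gaussianPDFReal m v y :=
      fun m y => gaussianPDFReal_nonneg _ _ _
    simp only [gaussianDensity]
    rw [← Real.finsetProd_rpow _ _ fun j _ => Finset.prod_nonneg fun a _ => h0 _ _,
      ← Real.finsetProd_rpow _ _ fun j _ => Finset.prod_nonneg fun a _ => h0 _ _,
      ← Finset.prod_mul_distrib, Finset.mul_sum, Real.exp_sum, ← Finset.prod_mul_distrib]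
    refine Finset.prod_congr rfl fun j _ => ?_
    rw [← Real.finsetProd_rpow _ _ fun a _ => h0 _ _,
      ← Real.finsetProd_rpow _ _ fun a _ => h0 _ _,
      ← Finset.prod_mul_distrib, Finset.mul_sum, Real.exp_sum, ← Finset.prod_mul_distrib]
    exact Finset.prod_congr rfl fun a _ => gaussianPDFReal_rpow_mul_rpow hv ρ _ _
  simp only [h, ENNReal.ofReal_mul (Real.exp_pos _).le]
  rw [lintegral_const_mul _ (measurable_gaussianDensity _ _).ennreal_ofReal,
    lintegral_gaussianDensity hv, mul_one]

lemma le_mul_add_rpow {p q t ρ : ℝ} (hp : 0 < p) (hq : 0 < q) (ht : 0 < t) (hρ : 0 ≤ ρ) :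
    p ≤ t * q + t ^ (-ρ) * (p ^ (1 + ρ) * q ^ (-ρ)) := by
  rcases le_total p (t * q) with h | h
  · have : 0 ≤ t ^ (-ρ) * (p ^ (1 + ρ) * q ^ (-ρ)) := by positivity
    linarith
  · have h1 : p = p ^ (1 + ρ) * p ^ (-ρ) := by
      rw [← Real.rpow_add hp, add_neg_cancel_right, Real.rpow_one]
    have h2 : p ^ (-ρ) ≤ t ^ (-ρ) * q ^ (-ρ) := by
      rw [← Real.mul_rpow ht.le hq.le]
      exact Real.rpow_le_rpow_of_nonpos (by positivity) h (neg_nonpos.2 hρ)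
    have h3 := mul_le_mul_of_nonneg_left h2 (Real.rpow_nonneg hp.le (1 + ρ))
    have h4 := mul_pos ht hq
    nlinarith

/-- A list-decoding strong converse: input-dependent events that cover each output at most `K`
times have small total probability when the codewords have bounded energy. -/
lemma sum_setLIntegral_gaussianDensity_le {M : Type*} [Fintype M] {v : ℝ≥0} (hv : v ≠ 0)
    (x : M → Fin n → Fin J → ℝ) {e ρ t : ℝ} (he : ∀ b, ∑ j, ∑ a, x b j a ^ 2 ≤ e) (hρ : 0 ≤ ρ)
    (ht : 0 < t) {G : M → Set (Fin n → Fin J → ℝ)} (hG : ∀ b, MeasurableSet (G b)) (K : ℕ)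
    (hK : ∀ y, Nat.card {b // y ∈ G b} ≤ K) :
    ∑ b, ∫⁻ y in G b, ENNReal.ofReal (gaussianDensity v (x b) y) ≤
      K * ENNReal.ofReal t +
        Fintype.card M * ENNReal.ofReal (t ^ (-ρ) * Real.exp (ρ * (1 + ρ) / (2 * v) * e)) := by
  classical
  have hm0 := (measurable_gaussianDensity v (0 : Fin n → Fin J → ℝ)).ennreal_ofReal
  have h1 : ∀ b, ∫⁻ y in G b, ENNReal.ofReal (gaussianDensity v (x b) y) ≤
      ENNReal.ofReal t * (∫⁻ y in G b, ENNReal.ofReal (gaussianDensity v 0 y)) +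
        ENNReal.ofReal (t ^ (-ρ) * Real.exp (ρ * (1 + ρ) / (2 * v) * e)) := by
    intro b
    have hm : Measurable fun y => ENNReal.ofReal
        (gaussianDensity v (x b) y ^ (1 + ρ) * gaussianDensity v 0 y ^ (-ρ)) :=
      (((measurable_gaussianDensity v (x b)).pow_const _).mul
        ((measurable_gaussianDensity v 0).pow_const _)).ennreal_ofReal
    calc _ ≤ ∫⁻ y in G b, (ENNReal.ofReal t * ENNReal.ofReal (gaussianDensity v 0 y) +
          ENNReal.ofReal (t ^ (-ρ)) * ENNReal.ofReal
            (gaussianDensity v (x b) y ^ (1 + ρ) * gaussianDensity v 0 y ^ (-ρ))) := by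
          refine lintegral_mono fun y => ?_
          have hp := gaussianDensity_pos hv (x b) y
          have hq := gaussianDensity_pos hv 0 y
          rw [← ENNReal.ofReal_mul ht.le, ← ENNReal.ofReal_mul (by positivity),
            ← ENNReal.ofReal_add (by positivity) (by positivity)]
          exact ENNReal.ofReal_le_ofReal (le_mul_add_rpow hp hq ht hρ)
      _ = ENNReal.ofReal t * (∫⁻ y in G b, ENNReal.ofReal (gaussianDensity v 0 y)) +
          ENNReal.ofReal (t ^ (-ρ)) * ∫⁻ y in G b, ENNReal.ofReal
            (gaussianDensity v (x b) y ^ (1 + ρ) * gaussianDensity v 0 y ^ (-ρ)) := by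
          rw [lintegral_add_left (hm0.const_mul _), lintegral_const_mul _ hm0,
            lintegral_const_mul _ hm]
      _ ≤ _ := by
          rw [ENNReal.ofReal_mul (by positivity)]
          gcongr
          refine (setLIntegral_le_lintegral _ _).trans ?_
          rw [lintegral_gaussianDensity_rpow hv]
          refine ENNReal.ofReal_le_ofReal (Real.exp_le_exp.2 ?_)
          gcongr
          exact he b
  have h2 : ∑ b, ∫⁻ y in G b, ENNReal.ofReal (gaussianDensity v 0 y) ≤ K := by
    simp only [← lintegral_indicator (hG _)]
    rw [← lintegral_finsetSum _ fun b _ => hm0.indicator (hG b)]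
    calc _ ≤ ∫⁻ y, (K : ℝ≥0∞) * ENNReal.ofReal (gaussianDensity v (0 : Fin n → Fin J → ℝ) y) := by
          refine lintegral_mono fun y => ?_
          simp only [Set.indicator_apply, ← Finset.sum_filter, Finset.sum_const, nsmul_eq_mul]
          gcongr
          have := hK y
          rwa [Nat.card_eq_fintype_card, Fintype.card_subtype] at this
      _ = _ := by rw [lintegral_const_mul _ hm0, lintegral_gaussianDensity hv, mul_one]
  refine (Finset.sum_le_sum fun b _ => h1 b).trans ?_
  rw [Finset.sum_add_distrib, ← Finset.mul_sum, Finset.sum_const, Finset.card_univ, nsmul_eq_mul,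
    mul_comm (K : ℝ≥0∞)]
  gcongr

end BlockConverse

section FixedDelay

variable {J : ℕ}

/-- The first `n` channel inputs of the causal encoder `f` on the message `b`. -/
def codeword (f : (k : ℕ) → (Fin k → Bool) → (Fin J → ℝ)) (n : ℕ) (b : Fin n → Bool) :
    Fin n → Fin J → ℝ :=
  fun j => f (j.val + 1) fun t => b (Fin.castLE j.isLt t)

lemma card_fiber_castLE_le {i m k : ℕ} (h : i ≤ m) (hm : m ≤ i + k) (c : Fin i → Bool) :
    Fintype.card {b : Fin m → Bool // (fun t => b (Fin.castLE h t)) = c} ≤ 2 ^ k := by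
  have hinj : Function.Injective
      (fun (b : {b : Fin m → Bool // (fun t => b (Fin.castLE h t)) = c}) (j : Fin k) =>
        if hj : i + j.val < m then b.1 ⟨i + j.val, hj⟩ else false) := by
    intro b b' hbb
    ext t
    by_cases ht : t.val < i
    · exact (congrFun b.2 ⟨t, ht⟩).trans (congrFun b'.2 ⟨t, ht⟩).symm
    · have := congrFun hbb ⟨t.val - i, by omega⟩
      have e : i + (t.val - i) = t.val := by omega
      simpa [e, t.isLt] using this
  simpa using Fintype.card_le_of_injective _ hinj

/-- Attenuating the noise-free outputs by `α` still allows a decoder of bit `i` that is told the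
earlier bits. -/
lemma exists_genie_decoder {N0 : ℝ} (hN0 : 0 < N0) {α θ μ c c' t δ : ℝ}
    (hθ : 0 ≤ θ) (hμ0 : 0 ≤ μ) (hμ1 : μ ≤ 1)
    (hc : c = (1 + θ - μ) * α - θ) (hc' : c' = (1 + θ - μ) * α ^ 2 - θ) (hcc : c ^ 2 < c')
    (ht : 0 < t) {i m k : ℕ} (him : i ≤ m) (hmk : m ≤ i + k)
    (s : (Fin m → Bool) → Fin m → Fin J → ℝ) (β : (Fin m → Bool) → Bool)
    {D : (Fin m → Fin J → ℝ) → Bool} (hD : Measurable D)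
    (hδ : bitNoiseMeasure m J N0 {ω | D (s ω.1 + ω.2) ≠ β ω.1} ≤ ENNReal.ofReal δ) :
    ∃ D' : (Fin i → Bool) → (Fin m → Fin J → ℝ) → Bool, (∀ c, Measurable (D' c)) ∧
      bitNoiseMeasure m J N0 {ω | D' (fun t => ω.1 (Fin.castLE him t))
        ((fun j a => α * s ω.1 j a) + ω.2) ≠ β ω.1} ≤
        ENNReal.ofReal (t * δ) + ENNReal.ofReal (t ^ (-θ) * (2 ^ k) ^ μ) := by
  classical
  have hv : (N0 / 2).toNNReal ≠ 0 := (Real.toNNReal_pos.2 (by positivity)).ne'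
  set v := (N0 / 2).toNNReal
  obtain ⟨D', hD', hle⟩ := exists_errorMass_le_of_preservesDomination
    (k := fun b => gaussianDensity v fun j a => α * s b j a) (l := fun b => gaussianDensity v (s b))
    (fun b => measurable_gaussianDensity _ _) (fun b y => (gaussianDensity_pos hv _ _).le)
    (fun b => measurable_gaussianDensity _ _) (fun b y => (gaussianDensity_pos hv _ _).le)
    hθ hμ0 ht (fun (b : Fin m → Bool) (t : Fin i) => b (Fin.castLE him t)) β (2 ^ k)
    (fun c => card_fiber_castLE_le him hmk c)
    (fun c => preservesDomination_gaussian_pi hv hμ0 hμ1 hc hc' hcc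
      fun b : {b : Fin m → Bool // (fun t => b (Fin.castLE him t)) = c} => s b) hD
  refine ⟨D', hD', ?_⟩
  have hms : ∀ {D : (Fin m → Fin J → ℝ) → Bool}, Measurable D → ∀ b, MeasurableSet {y | D y ≠ b} :=
    fun hD b => hD (MeasurableSet.of_discrete (s := {c | c ≠ b}))
  have h1 := bitNoiseMeasure_add_mem hN0 (fun b j a => α * s b j a)
    (E := fun b => {y | D' (fun t => b (Fin.castLE him t)) y ≠ β b}) (fun b => hms (hD' _) _)
  have h2 := bitNoiseMeasure_add_mem hN0 s (E := fun b => {y | D y ≠ β b}) (fun b => hms hD _)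
  have hcast : ∀ {D : (Fin m → Fin J → ℝ) → Bool}, Measurable D → ∀ (b : Bool)
      (φ : (Fin m → Fin J → ℝ) → ℝ), ∫⁻ y in {y | D y ≠ b}, ENNReal.ofReal (φ y) =
      ∫⁻ y, if D y ≠ b then ENNReal.ofReal (φ y) else 0 := by
    intro D hD b φ
    rw [← lintegral_indicator (hms hD b)]
    exact lintegral_congr fun y => by simp only [Set.indicator_apply, Set.mem_ofPred_eq]
  simp only [hcast (hD' _)] at h1
  simp only [hcast hD] at h2
  have hδ' : (2 ^ m)⁻¹ * errorMass (fun b => gaussianDensity v (s b)) β D ≤ ENNReal.ofReal δ := by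
    rw [errorMass]
    exact h2.symm.le.trans hδ
  refine h1.le.trans ((mul_le_mul_right hle _).trans ?_)
  rw [mul_add, mul_left_comm, ENNReal.ofReal_mul ht.le]
  refine add_le_add (mul_le_mul_right hδ' _) (le_of_eq ?_)
  rw [ENNReal.ofReal_mul (by positivity), ← mul_assoc]
  simp only [Fintype.card_pi, Fintype.card_bool, Finset.prod_const, Finset.card_univ,
    Fintype.card_fin, Nat.cast_pow, Nat.cast_ofNat]
  rw [ENNReal.ofReal_pow (by norm_num), ENNReal.ofReal_ofNat, ENNReal.inv_mul_cancel (by simp)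
    (by simp), one_mul]

/-- Sequentially correct decisions leave at most `2 ^ d` messages for each output. -/
lemma card_sequentially_correct_le {n d : ℕ}
    (g : (i : ℕ) → i < n → (Fin i → Bool) → Bool) :
    Nat.card {b : Fin (n + d) → Bool // ∀ (i : ℕ) (hi : i < n),
      g i hi (fun t => b (Fin.castLE (by omega) t)) = b ⟨i, by omega⟩} ≤ 2 ^ d := by
  have hinj : Function.Injective (fun (b : {b : Fin (n + d) → Bool // ∀ (i : ℕ) (hi : i < n),
      g i hi (fun t => b (Fin.castLE (by omega) t)) = b ⟨i, by omega⟩}) (j : Fin d) =>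
      b.1 (Fin.natAdd n j)) := by
    intro b b' hbb
    have h : ∀ (i : ℕ) (hi : i < n), b.1 ⟨i, by omega⟩ = b'.1 ⟨i, by omega⟩ := by
      intro i
      induction i using Nat.strong_induction_on with
      | _ i ih =>
        intro hi
        rw [← b.2 i hi, ← b'.2 i hi]
        congr 1
        funext t
        exact ih t.val t.isLt (by have := t.isLt; omega)
    ext t
    by_cases ht : t.val < n
    · exact h t ht
    · have := congrFun hbb ⟨t.val - n, by have := t.isLt; omega⟩
      have e : Fin.natAdd n (⟨t.val - n, by have := t.isLt; omega⟩ : Fin d) = t :=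
        Fin.ext (by simp; omega)
      simpa only [e] using this
  simpa using Nat.card_le_card_of_injective _ hinj

/-- If all bits of a fixed-delay code are decoded with error probability at most `δ`, then the
cost of the attenuated-signal decoders and of the block converse add up to at least `1`. -/
lemma one_le_of_forall_error_le {N0 : ℝ} (hN0 : 0 < N0) {α θ μ c c' t δ ρ t' e : ℝ}
    (hθ : 0 ≤ θ) (hμ0 : 0 ≤ μ) (hμ1 : μ ≤ 1)
    (hc : c = (1 + θ - μ) * α - θ) (hc' : c' = (1 + θ - μ) * α ^ 2 - θ) (hcc : c ^ 2 < c')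
    (ht : 0 < t) (hδ0 : 0 ≤ δ) (hρ : 0 ≤ ρ) (ht' : 0 < t') {n d : ℕ}
    {f : (k : ℕ) → (Fin k → Bool) → (Fin J → ℝ)}
    (hf : ∀ b, ∑ j, ∑ a, codeword f (n + d) b j a ^ 2 ≤ e)
    {D : (i : ℕ) → (Fin (i + 1 + d) → Fin J → ℝ) → Bool} (hD : ∀ i, Measurable (D i))
    (hδ : ∀ i, bitNoiseMeasure (i + 1 + d) J N0
      {ω | D i (codeword f (i + 1 + d) ω.1 + ω.2) ≠ ω.1 ⟨i, by omega⟩} ≤ ENNReal.ofReal δ) :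
    1 ≤ n * (t * δ + t ^ (-θ) * (2 ^ (d + 1)) ^ μ) +
      (t' / 2 ^ n + t' ^ (-ρ) * Real.exp (ρ * (1 + ρ) / N0 * (α ^ 2 * e))) := by
  classical
  have hv : (N0 / 2).toNNReal ≠ 0 := (Real.toNNReal_pos.2 (by positivity)).ne'
  have hvc : 2 * ((N0 / 2).toNNReal : ℝ) = N0 := by
    rw [Real.coe_toNNReal _ (by positivity)]; ring
  choose D' hD' hle using fun i => exists_genie_decoder hN0 hθ hμ0 hμ1 hc hc' hcc ht
    (k := d + 1) (show i ≤ i + 1 + d by omega) (by omega) (codeword f (i + 1 + d))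
    (fun b => b ⟨i, by omega⟩) (hD i) (hδ i)
  set G : (Fin (n + d) → Bool) → Set (Fin (n + d) → Fin J → ℝ) := fun b =>
    {y | ∀ (i : ℕ) (hi : i < n), D' i (fun t => b (Fin.castLE (by omega) t))
      (fun j => y (Fin.castLE (by omega) j)) = b ⟨i, by omega⟩} with hGdef
  have hG : ∀ b, MeasurableSet (G b) := by
    intro b
    simp only [hGdef, Set.ofPred_forall]
    refine MeasurableSet.iInter fun i => MeasurableSet.iInter fun hi => ?_
    exact ((hD' i _).comp (measurable_pi_lambda _ fun j => measurable_pi_apply _))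
      (MeasurableSet.singleton (b ⟨i, by omega⟩))
  set B : Fin n → Set ((Fin (n + d) → Bool) × (Fin (n + d) → Fin J → ℝ)) := fun i =>
    (fun ω => ((fun j => ω.1 (Fin.castLE (by omega) j), fun j => ω.2 (Fin.castLE (by omega) j)) :
        (Fin (i + 1 + d) → Bool) × (Fin (i + 1 + d) → Fin J → ℝ))) ⁻¹'
      {ω | D' i (fun t => ω.1 (Fin.castLE (by omega) t))
        ((fun j a => α * codeword f (i + 1 + d) ω.1 j a) + ω.2) ≠ ω.1 ⟨i, by omega⟩} with hB
  have hcover : Set.univ ⊆ {ω : (Fin (n + d) → Bool) × (Fin (n + d) → Fin J → ℝ) |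
      (fun j a => α * codeword f (n + d) ω.1 j a) + ω.2 ∈ G ω.1} ∪ ⋃ i, B i := by
    intro ω _
    by_cases h : (fun j a => α * codeword f (n + d) ω.1 j a) + ω.2 ∈ G ω.1
    · exact Or.inl h
    · refine Or.inr ?_
      simp only [hGdef, Set.mem_ofPred_eq, not_forall] at h
      obtain ⟨i, hi, hne⟩ := h
      exact Set.mem_iUnion.2 ⟨⟨i, hi⟩, hne⟩
  have hBle : ∀ i, bitNoiseMeasure (n + d) J N0 (B i) ≤
      ENNReal.ofReal (t * δ + t ^ (-θ) * (2 ^ (d + 1)) ^ μ) := by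
    intro i
    rw [ENNReal.ofReal_add (by positivity) (by positivity)]
    refine le_trans ?_ (hle i)
    have hmp := measurePreserving_bitNoiseMeasure (J := J)
      (show i.val + 1 + d ≤ n + d by have := i.isLt; omega) N0
    rw [← hmp.map_eq]
    exact Measure.le_map_apply hmp.aemeasurable _
  have hGle : bitNoiseMeasure (n + d) J N0
      {ω | (fun j a => α * codeword f (n + d) ω.1 j a) + ω.2 ∈ G ω.1} ≤
      ENNReal.ofReal (t' / 2 ^ n + t' ^ (-ρ) * Real.exp (ρ * (1 + ρ) / N0 * (α ^ 2 * e))) := by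
    rw [bitNoiseMeasure_add_mem hN0 (fun b j a => α * codeword f (n + d) b j a) hG]
    have h := sum_setLIntegral_gaussianDensity_le hv
      (fun b j a => α * codeword f (n + d) b j a) (e := α ^ 2 * e) (fun b => by
        simp only [mul_pow, ← Finset.mul_sum]
        exact mul_le_mul_of_nonneg_left (hf b) (sq_nonneg α)) hρ ht' hG (2 ^ d) (fun y =>
        card_sequentially_correct_le fun i hi p => D' i p fun j => y (Fin.castLE (by omega) j))
    rw [hvc] at h
    refine (mul_le_mul_right h _).trans (le_of_eq ?_)
    have hN : (2 : ℝ≥0∞) ^ (n + d) = ENNReal.ofReal (2 ^ (n + d)) := by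
      rw [ENNReal.ofReal_pow (by norm_num)]; norm_num
    have hcard : ((Fintype.card (Fin (n + d) → Bool) : ℕ) : ℝ≥0∞) =
      ENNReal.ofReal (2 ^ (n + d)) := by simp [← hN]
    have hK : (((2 : ℕ) ^ d : ℕ) : ℝ≥0∞) = ENNReal.ofReal (2 ^ d) := by
      rw [ENNReal.ofReal_pow (by norm_num)]; norm_num
    rw [hcard, hK, hN, ← ENNReal.ofReal_inv_of_pos (by positivity),
      ← ENNReal.ofReal_mul (by positivity), ← ENNReal.ofReal_mul (by positivity),
      ← ENNReal.ofReal_add (by positivity) (by positivity), ← ENNReal.ofReal_mul (by positivity)]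
    congr 1
    rw [pow_add]
    field_simp
  have hprob : bitNoiseMeasure (n + d) J N0 Set.univ = 1 := by
    have : IsProbabilityMeasure (bitNoiseMeasure (n + d) J N0) := by
      unfold bitNoiseMeasure; infer_instance
    exact measure_univ
  have hfin : (1 : ℝ≥0∞) ≤ ENNReal.ofReal (n * (t * δ + t ^ (-θ) * (2 ^ (d + 1)) ^ μ) +
      (t' / 2 ^ n + t' ^ (-ρ) * Real.exp (ρ * (1 + ρ) / N0 * (α ^ 2 * e)))) := by
    rw [← hprob, ENNReal.ofReal_add (by positivity) (by positivity), add_comm (ENNReal.ofReal _)]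
    refine (measure_mono hcover).trans ((measure_union_le _ _).trans (add_le_add hGle ?_))
    refine (measure_iUnion_fintype_le _ _).trans ((Finset.sum_le_sum fun i _ => hBle i).trans ?_)
    rw [Finset.sum_const, Finset.card_univ, Fintype.card_fin, nsmul_eq_mul,
      ENNReal.ofReal_mul (by positivity), ENNReal.ofReal_natCast]
  exact ENNReal.one_le_ofReal.1 hfin

end FixedDelay

section Parameters

/-- An attenuation `α` below `1 / x` keeps the tilted moment contractive for small tilts. -/
lemma exists_tilt {y z : ℝ} (hy : 0 < y) (hyz : y < z) :
    ∃ θ : ℝ, 0 < θ ∧ z ^ 2 * θ ≤ 1 ∧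
      ((1 + θ - z ^ 2 * θ) * (1 + y)⁻¹ - θ) ^ 2 < (1 + θ - z ^ 2 * θ) * (1 + y)⁻¹ ^ 2 - θ := by
  set α := (1 + y)⁻¹ with hα
  have hα0 : 0 < α := by positivity
  have hαy : α * y = 1 - α := by rw [hα]; field_simp; ring
  set k := (1 - z ^ 2) * α - 1 with hk
  have hΔ : 0 < α ^ 2 * (z ^ 2 - y ^ 2) := by
    have : y ^ 2 < z ^ 2 := by gcongr
    have := sub_pos.2 this
    positivity
  set Δ := α ^ 2 * (z ^ 2 - y ^ 2) with hΔd
  have hz : 0 < z := hy.trans hyz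
  refine ⟨min (z ^ 2)⁻¹ (Δ / (k ^ 2 + 1)), by positivity, ?_, ?_⟩
  · refine (mul_le_mul_of_nonneg_left (min_le_left _ _) (sq_nonneg z)).trans ?_
    rw [mul_inv_cancel₀ (by positivity)]
  · set θ := min (z ^ 2)⁻¹ (Δ / (k ^ 2 + 1)) with hθ
    have hθ0 : 0 < θ := by positivity
    have hθk : θ * (k ^ 2 + 1) ≤ Δ := by
      rw [← le_div_iff₀ (by positivity)]; exact min_le_right _ _
    have h1 : (1 + θ - z ^ 2 * θ) * α ^ 2 - θ - ((1 + θ - z ^ 2 * θ) * α - θ) ^ 2 =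
        θ * (Δ - θ * k ^ 2) := by
      have h2 : Δ = α ^ 2 * z ^ 2 - (1 - α) ^ 2 := by rw [hΔd, ← hαy]; ring
      rw [h2, hk]; ring
    have h3 : 0 < θ * (Δ - θ * k ^ 2) := mul_pos hθ0 (by linarith)
    linarith

lemma tendsto_exp_neg_mul_nat {r : ℝ} (hr : 0 < r) :
    Filter.Tendsto (fun d : ℕ => Real.exp (-(d * r))) Filter.atTop (nhds 0) := by
  have := tendsto_pow_atTop_nhds_zero_of_lt_one (Real.exp_pos (-r)).le
    (Real.exp_lt_one_iff.2 (neg_neg_of_pos hr))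
  refine this.congr fun d => ?_
  rw [← Real.exp_nat_mul]; ring_nf

lemma tendsto_nat_mul_exp_neg_mul_nat {r : ℝ} (hr : 0 < r) :
    Filter.Tendsto (fun d : ℕ => (d : ℝ) * Real.exp (-(d * r))) Filter.atTop (nhds 0) := by
  have := tendsto_self_mul_const_pow_of_lt_one (Real.exp_pos (-r)).le
    (Real.exp_lt_one_iff.2 (neg_neg_of_pos hr))
  refine this.congr fun d => ?_
  rw [← Real.exp_nat_mul]; ring_nf

lemma exists_parameters {x E : ℝ} (hx : 1 < x) (hE : Real.log 2 * (x - 1) ^ 2 < E) :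
    ∃ α θ μ ρ B B' : ℝ, ∃ K d0 : ℕ, 0 ≤ θ ∧ 0 ≤ μ ∧ μ ≤ 1 ∧
      ((1 + θ - μ) * α - θ) ^ 2 < (1 + θ - μ) * α ^ 2 - θ ∧ 0 ≤ ρ ∧
      ∀ d : ℕ, d0 ≤ d →
        ((K * d : ℕ) : ℝ) * (Real.exp (d * B') * Real.exp (-d * E) +
            Real.exp (d * B') ^ (-θ) * (2 ^ (d + 1)) ^ μ) +
          (Real.exp (d * B) / 2 ^ (K * d) + Real.exp (d * B) ^ (-ρ) *
            Real.exp (ρ * (1 + ρ) * (α ^ 2 * ((((K * d : ℕ) : ℝ) + d) * x ^ 2 * Real.log 2)))) <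
          1 := by
  have hL : 0 < Real.log 2 := Real.log_pos (by norm_num)
  set L := Real.log 2 with hLd
  have hq : x - 1 < √(E / L) := by
    rw [Real.lt_sqrt (by linarith), lt_div_iff₀ hL]; linarith
  obtain ⟨y, hxy, hyq⟩ := exists_between hq
  obtain ⟨z, hyz, hzq⟩ := exists_between hyq
  obtain ⟨w, hzw, hwq⟩ := exists_between hzq
  have hy : 0 < y := by linarith
  have hw : 0 < w := by linarith
  obtain ⟨θ, hθ, hμ1, hcc⟩ := exists_tilt hy hyz
  have hwE : L * w ^ 2 < E := by
    rw [Real.lt_sqrt hw.le, lt_div_iff₀ hL] at hwq; linarith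
  have hzw2 : z ^ 2 < w ^ 2 := by
    have : 0 < z := by linarith
    gcongr
  set κ := ((1 + y)⁻¹) ^ 2 * x ^ 2 with hκ
  have hκ0 : 0 < κ := by positivity
  have hκ1 : κ < 1 := by
    rw [hκ, ← mul_pow, inv_mul_eq_div]
    refine pow_lt_one₀ (by positivity) ?_ (by norm_num)
    rw [div_lt_one (by positivity)]; linarith
  obtain ⟨K, hK⟩ := exists_nat_gt (κ / (1 - κ))
  have hK' : (K + 1) * κ < K := by
    rw [div_lt_iff₀ (by linarith)] at hK; linarith
  set A := (K + 1) * κ * L with hA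
  have hA0 : 0 < A := by positivity
  have hAK : A < K * L := by rw [hA]; gcongr
  set ρ := (K * L - A) / (2 * A) with hρ
  have hρ0 : 0 < ρ := div_pos (by linarith) (by positivity)
  have hρA : (1 + ρ) * A < K * L := by
    have : ρ * A = (K * L - A) / 2 := by rw [hρ]; field_simp
    linarith
  obtain ⟨B, hB1, hB2⟩ := exists_between hρA
  have hr1 : 0 < E - L * w ^ 2 := by linarith
  have hr2 : 0 < θ * (L * w ^ 2 - L * z ^ 2) :=
    mul_pos hθ (sub_pos.2 (mul_lt_mul_of_pos_left hzw2 hL))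
  have hr3 : 0 < K * L - B := by linarith
  have hr4 : 0 < ρ * (B - (1 + ρ) * A) := mul_pos hρ0 (by linarith)
  have hlim := (((tendsto_nat_mul_exp_neg_mul_nat hr1).add
    ((tendsto_nat_mul_exp_neg_mul_nat hr2).const_mul (Real.exp (z ^ 2 * θ * L)))).const_mul
    (K : ℝ)).add ((tendsto_exp_neg_mul_nat hr3).add (tendsto_exp_neg_mul_nat hr4))
  simp only [mul_zero, add_zero] at hlim
  obtain ⟨d0, hd0⟩ := Filter.eventually_atTop.1 (hlim.eventually_lt_const one_pos)
  refine ⟨(1 + y)⁻¹, θ, z ^ 2 * θ, ρ, B, L * w ^ 2, K, d0, hθ.le, by positivity, hμ1, hcc, hρ0.le,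
    fun d hd => (le_of_eq ?_).trans_lt (hd0 d hd)⟩
  have h2 : ∀ m : ℕ, (2 : ℝ) ^ m = Real.exp (m * L) := fun m => by
    rw [Real.exp_nat_mul, hLd, Real.exp_log (by norm_num)]
  rw [h2, h2, ← Real.exp_mul, ← Real.exp_mul, ← Real.exp_mul, ← Real.exp_add, ← Real.exp_add,
    ← Real.exp_add, ← Real.exp_sub]
  have e1 : d * (L * w ^ 2) + -d * E = -(d * (E - L * w ^ 2)) := by ring
  have e2 : d * (L * w ^ 2) * -θ + ((d + 1 : ℕ) : ℝ) * L * (z ^ 2 * θ) =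
      z ^ 2 * θ * L + -(d * (θ * (L * w ^ 2 - L * z ^ 2))) := by push_cast; ring
  have e3 : d * B - ((K * d : ℕ) : ℝ) * L = -(d * (K * L - B)) := by push_cast; ring
  have e4 : d * B * -ρ + ρ * (1 + ρ) * ((1 + y)⁻¹ ^ 2 * ((((K * d : ℕ) : ℝ) + d) * x ^ 2 * L)) =
      -(d * (ρ * (B - (1 + ρ) * A))) := by rw [hA, hκ]; push_cast; ring
  rw [e1, e2, e3, e4, Real.exp_add]
  push_cast
  ring

end Parameters

/-- Upper bound on the delay error exponent for the power-constrained AWGN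
channel without feedback.  Fix `P, N₀ > 0` and a rate `0 < R < C∞` where
`C∞ = (P/N₀)·log₂ e`, and set `τ = 1/R`.  For every `ε > 0` there is a `d₀`
such that for all delays `d ≥ d₀`, every dimension `J ≥ 1`, every causal
encoder `f` (with `f k` giving the slot-`k` output as a function of the first
`k` bits) satisfying the power constraint
`∑_{j=1}^k ‖f_j(b_1,…,b_j)‖² ≤ k·τ·P` for all `k ≥ 1` and all bit strings,
and every (measurable) delay-`d` decoder `D`, there is a bit index `i ≥ 1`
whose error probability is at least
`exp(−d·τ·(ln 2·(√C∞ − √R)² + ε))`.  Hence no fixed-delay code without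
feedback beats the exponent `ln 2·(√C∞ − √R)²`, the high-rate branch of the
orthogonal-coding exponent. -/
theorem awgn_delay_exponent_converse
    (P N0 : ℝ) (hP : 0 < P) (hN0 : 0 < N0)
    (R : ℝ) (hR : 0 < R) (hRC : R < (P / N0) * Real.logb 2 (Real.exp 1))
    (ε : ℝ) (hε : 0 < ε) :
    ∃ d0 : ℕ, ∀ d : ℕ, d0 ≤ d → ∀ J : ℕ, 1 ≤ J →
      ∀ f : (k : ℕ) → (Fin k → Bool) → (Fin J → ℝ),
        (∀ k : ℕ, 1 ≤ k → ∀ b : Fin k → Bool,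
          ∑ j : Fin k, ∑ a : Fin J,
            (f (j.val + 1) (fun t => b (Fin.castLE j.isLt t)) a) ^ 2 ≤
            (k : ℝ) * (1 / R) * P) →
      ∀ D : (i : ℕ) → (Fin (i + d) → Fin J → ℝ) → Bool,
        (∀ i : ℕ, Measurable (D i)) →
      ∃ i : ℕ, ∃ hi : 1 ≤ i,
        bitNoiseMeasure (i + d) J N0
            {ω | D i (fun j a =>
                f (j.val + 1) (fun t => ω.1 (Fin.castLE j.isLt t)) a + ω.2 j a) ≠
              ω.1 ⟨i - 1, by omega⟩} ≥
          ENNReal.ofReal (Real.exp (-(d : ℝ) * (1 / R) *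
            (Real.log 2 *
                (Real.sqrt ((P / N0) * Real.logb 2 (Real.exp 1)) - Real.sqrt R) ^ 2
              + ε))) := by
  set C := (P / N0) * Real.logb 2 (Real.exp 1) with hC
  have hL : 0 < Real.log 2 := Real.log_pos (by norm_num)
  have hsR : 0 < √R := Real.sqrt_pos.2 hR
  have hCL : C * Real.log 2 = P / N0 := by
    rw [hC, Real.logb, Real.log_exp]; field_simp
  have hC0 : 0 < C := hR.trans hRC
  set x := √C / √R with hx
  have hx1 : 1 < x := by
    rw [hx, one_lt_div hsR]; exact Real.sqrt_lt_sqrt hR.le hRC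
  have hx2 : x ^ 2 = C / R := by
    rw [hx, div_pow, Real.sq_sqrt hC0.le, Real.sq_sqrt hR.le]
  set E := (1 / R) * (Real.log 2 * (√C - √R) ^ 2 + ε) with hE
  have hxE : Real.log 2 * (x - 1) ^ 2 < E := by
    have h1 : (x - 1) ^ 2 = (√C - √R) ^ 2 / R := by
      rw [hx, div_sub_one hsR.ne', div_pow, Real.sq_sqrt hR.le]
    have h2 : E = Real.log 2 * (x - 1) ^ 2 + ε / R := by rw [h1, hE]; ring
    have := div_pos hε hR
    linarith
  obtain ⟨α, θ, μ, ρ, B, B', K, d0, hθ, hμ0, hμ1, hcc, hρ, hlt⟩ := exists_parameters hx1 hxE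
  refine ⟨max d0 1, fun d hd J _ f hf D hD => ?_⟩
  by_contra! hcon
  have h := one_le_of_forall_error_le (n := K * d) (d := d) (f := f)
    (D := fun i => D (i + 1)) (t := Real.exp (d * B')) (t' := Real.exp (d * B))
    (δ := Real.exp (-d * E)) hN0 hθ hμ0 hμ1 rfl rfl hcc (Real.exp_pos _) (Real.exp_pos _).le
    hρ (Real.exp_pos _) (e := ((K * d + d : ℕ) : ℝ) * (1 / R) * P)
    (hf (K * d + d) (le_add_left ((le_max_right _ _).trans hd))) (fun i => hD (i + 1))
    (fun i => by
      have := (hcon (i + 1) (by omega)).le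
      rw [mul_assoc, ← hE] at this
      exact this)
  have he : ρ * (1 + ρ) / N0 * (α ^ 2 * (((K * d + d : ℕ) : ℝ) * (1 / R) * P)) =
      ρ * (1 + ρ) * (α ^ 2 * ((((K * d : ℕ) : ℝ) + d) * x ^ 2 * Real.log 2)) := by
    have : P = C * Real.log 2 * N0 := by rw [hCL]; field_simp
    rw [hx2, this]
    push_cast
    field_simp
  rw [he] at h
  exact absurd (hlt d ((le_max_left _ _).trans hd)) (not_lt.2 h)
end
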